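/- arXiv:2305.18659 — 2 statements merged into one kernel-verified Lean document; each statement's English description precedes it below -/
import Mathlib

section
/- Let Ω₊ ⊆ Ω ⊆ ℝⁿ be open bounded sets, Ω₋ = Ω \ closure(Ω₊), and Γ = Ω \ (Ω₊∪Ω₋) = ∂Ω₋∩Ω = ∂Ω₊∩Ω. Assume Ω₋ and Ω₊ have uniformly Lipschitz regular boundaries. Then there exists u ∈ C(closure(Ω)) with u = 0 on ∂Ω which is a viscosity solution in Ω of the relaxed transmission problem for the eikonal operator H₋φ = |Dφ| − 1 on Ω₋∪Γ and the operator H₊φ = (1/2)(−Δφ) − 1 on Ω₊∪Γ; that is, u is both a viscosity sub-solution of {|Du| − 1 ≤ 0 in Ω₋, (1/2)(−Δu) − 1 ≤ 0 in Ω₊, min(|Du| − 1, (1/2)(−Δu) − 1) ≤ 0 on Γ} and a viscosity super-solution of {|Du| − 1 ≥ 0 in Ω₋, (1/2)(−Δu) − 1 ≥ 0 in Ω₊, max(|Du| − 1, (1/2)(−Δu) − 1) ≥ 0 on Γ}. -/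
open Metric Set Filter Topology Bornology

noncomputable section

abbrev Euc (n : ℕ) := EuclideanSpace ℝ (Fin n)

/-- Hessian matrix of a function at a point (second iterated Fréchet derivative,
a purely local notion). -/
def hessianMatrix {n : ℕ} (φ : Euc n → ℝ) (x : Euc n) : Matrix (Fin n) (Fin n) ℝ :=
  Matrix.of fun i j =>
    iteratedFDeriv ℝ 2 φ x ![EuclideanSpace.single i (1 : ℝ), EuclideanSpace.single j (1 : ℝ)]

/-- Evaluation of a second-order operator on a C² function. -/
def evalOp2 {n : ℕ} (H : Matrix (Fin n) (Fin n) ℝ → Euc n → ℝ → Euc n → ℝ)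
    (φ : Euc n → ℝ) (x : Euc n) : ℝ :=
  H (hessianMatrix φ x) (gradient φ x) (φ x) x

/-- Evaluation of a first-order operator on a differentiable function. -/
def evalOp1 {n : ℕ} (H : Euc n → ℝ → Euc n → ℝ) (φ : Euc n → ℝ) (x : Euc n) : ℝ :=
  H (gradient φ x) (φ x) x

/-- `φ` is an admissible C² test function touching `u` from above at `x₀` on `ball x₀ r ⊆ Ω`. -/
def SubTest {n : ℕ} (Ω : Set (Euc n)) (u : Euc n → ℝ) (x₀ : Euc n)
    (φ : Euc n → ℝ) (r : ℝ) : Prop :=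
  0 < r ∧ ball x₀ r ⊆ Ω ∧ ContDiffOn ℝ 2 φ (ball x₀ r) ∧
    (∀ x ∈ ball x₀ r, u x ≤ φ x) ∧ u x₀ = φ x₀

/-- `φ` is an admissible C² test function touching `u` from below at `x₀` on `ball x₀ r ⊆ Ω`. -/
def SupTest {n : ℕ} (Ω : Set (Euc n)) (u : Euc n → ℝ) (x₀ : Euc n)
    (φ : Euc n → ℝ) (r : ℝ) : Prop :=
  0 < r ∧ ball x₀ r ⊆ Ω ∧ ContDiffOn ℝ 2 φ (ball x₀ r) ∧
    (∀ x ∈ ball x₀ r, φ x ≤ u x) ∧ u x₀ = φ x₀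

/-- Viscosity sub-solution of the relaxed transmission problem with a first-order
operator on `Ω₋` and a second-order operator on `Ω₊`. -/
def RelaxedSub1 {n : ℕ} (Ω Ωm Ωp Γ : Set (Euc n)) (Hm : Euc n → ℝ → Euc n → ℝ)
    (Hp : Matrix (Fin n) (Fin n) ℝ → Euc n → ℝ → Euc n → ℝ) (u : Euc n → ℝ) : Prop :=
  ∀ x₀ : Euc n, ∀ φ : Euc n → ℝ, ∀ r : ℝ, SubTest Ω u x₀ φ r →
    (x₀ ∈ Ωm → evalOp1 Hm φ x₀ ≤ 0) ∧ (x₀ ∈ Ωp → evalOp2 Hp φ x₀ ≤ 0) ∧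
      (x₀ ∈ Γ → min (evalOp1 Hm φ x₀) (evalOp2 Hp φ x₀) ≤ 0)

/-- Viscosity super-solution of the relaxed transmission problem with a first-order
operator on `Ω₋` and a second-order operator on `Ω₊`. -/
def RelaxedSuper1 {n : ℕ} (Ω Ωm Ωp Γ : Set (Euc n)) (Hm : Euc n → ℝ → Euc n → ℝ)
    (Hp : Matrix (Fin n) (Fin n) ℝ → Euc n → ℝ → Euc n → ℝ) (u : Euc n → ℝ) : Prop :=
  ∀ x₀ : Euc n, ∀ φ : Euc n → ℝ, ∀ r : ℝ, SupTest Ω u x₀ φ r →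
    (x₀ ∈ Ωm → 0 ≤ evalOp1 Hm φ x₀) ∧ (x₀ ∈ Ωp → 0 ≤ evalOp2 Hp φ x₀) ∧
      (x₀ ∈ Γ → 0 ≤ max (evalOp1 Hm φ x₀) (evalOp2 Hp φ x₀))

/-- `A` has uniformly Lipschitz regular boundary. -/
def UnifLipschitzBoundary {n : ℕ} (A : Set (Euc (n + 1))) : Prop :=
  ∃ K : NNReal, 0 < K ∧ ∀ x₀ ∈ frontier A, ∃ Φ Ψ : Euc (n + 1) → Euc (n + 1),
    ∃ U : Set (Euc (n + 1)),
    IsOpen U ∧ x₀ ∈ U ∧ Φ 0 = x₀ ∧ U = Φ '' ball 0 1 ∧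
    LipschitzOnWith K Φ (ball 0 1) ∧ LipschitzOnWith K Ψ U ∧
    (∀ x ∈ ball (0 : Euc (n + 1)) 1, Ψ (Φ x) = x) ∧ (∀ y ∈ U, Φ (Ψ y) = y) ∧
    Φ '' (ball 0 1 ∩ {x | x (Fin.last n) < 0}) = U \ closure A ∧
    Φ '' (ball 0 1 ∩ {x | 0 < x (Fin.last n)}) = U ∩ A ∧
    Φ '' (ball 0 1 ∩ {x | x (Fin.last n) = 0}) = U ∩ frontier A

/-- The Laplacian, written as the trace of the Hessian matrix. -/
def lap {n : ℕ} (φ : Euc n → ℝ) (x : Euc n) : ℝ := (hessianMatrix φ x).trace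

lemma lap_eq_sum {n : ℕ} (φ : Euc n → ℝ) (x : Euc n) :
    lap φ x = ∑ i, fderiv ℝ (fderiv ℝ φ) x (EuclideanSpace.single i 1)
      (EuclideanSpace.single i 1) := by
  simp [lap, Matrix.trace, hessianMatrix, iteratedFDeriv_two_apply]

lemma lap_eq_laplacian {n : ℕ} (φ : Euc n → ℝ) (x : Euc n) :
    lap φ x = Laplacian.laplacian φ x := by
  rw [InnerProductSpace.laplacian_eq_iteratedFDeriv_orthonormalBasis φ
    (EuclideanSpace.basisFun (Fin n) ℝ)]
  simp [lap, Matrix.trace, hessianMatrix]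

lemma lap_add {n : ℕ} {φ ψ : Euc n → ℝ} {x : Euc n} (hφ : ContDiffAt ℝ 2 φ x)
    (hψ : ContDiffAt ℝ 2 ψ x) : lap (fun y => φ y + ψ y) x = lap φ x + lap ψ x := by
  simp only [lap_eq_laplacian]
  exact hφ.laplacian_add hψ

lemma lap_const_mul {n : ℕ} {φ : Euc n → ℝ} {x : Euc n} (c : ℝ) (hφ : ContDiffAt ℝ 2 φ x) :
    lap (fun y => c * φ y) x = c * lap φ x := by
  simp only [lap_eq_laplacian]
  exact InnerProductSpace.laplacian_smul c hφ

lemma lap_const {n : ℕ} (c : ℝ) (x : Euc n) : lap (fun _ => c) x = 0 := by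
  rw [lap_eq_laplacian]
  exact congrFun InnerProductSpace.laplacian_const x

/-- The first derivative of a `C²` function along a line. -/
lemma deriv_line_eventuallyEq {n : ℕ} {φ : Euc n → ℝ} {x : Euc n} (hφ : ContDiffAt ℝ 2 φ x)
    (v : Euc n) : deriv (fun t : ℝ => φ (x + t • v)) =ᶠ[𝓝 0]
      fun t : ℝ => fderiv ℝ φ (x + t • v) v := by
  have hline : Tendsto (fun t : ℝ => x + t • v) (𝓝 0) (𝓝 x) := by
    have : Continuous (fun t : ℝ => x + t • v) := by fun_prop
    simpa using this.tendsto 0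
  have hev : ∀ᶠ y in 𝓝 x, ContDiffAt ℝ 2 φ y := hφ.eventually (by simp)
  filter_upwards [hline.eventually hev] with t ht
  have h1 : HasDerivAt (fun t : ℝ => x + t • v) v t := by
    simpa using ((hasDerivAt_id t).smul_const v).const_add x
  exact ((ht.differentiableAt (by simp)).hasFDerivAt.comp_hasDerivAt t h1).deriv

lemma deriv_deriv_line {n : ℕ} {φ : Euc n → ℝ} {x : Euc n} (hφ : ContDiffAt ℝ 2 φ x)
    (v : Euc n) : deriv (deriv (fun t : ℝ => φ (x + t • v))) 0 =
      fderiv ℝ (fderiv ℝ φ) x v v := by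
  rw [(deriv_line_eventuallyEq hφ v).deriv_eq]
  have h1 : HasDerivAt (fun t : ℝ => x + t • v) v 0 := by
    simpa using ((hasDerivAt_id (0 : ℝ)).smul_const v).const_add x
  have h2 : DifferentiableAt ℝ (fderiv ℝ φ) x :=
    (hφ.fderiv_right (m := 1) (by norm_num)).differentiableAt (by simp)
  have h3 : HasFDerivAt (fderiv ℝ φ) (fderiv ℝ (fderiv ℝ φ) x) (x + (0 : ℝ) • v) := by
    simpa using h2.hasFDerivAt
  have h4 : HasDerivAt (fun t : ℝ => fderiv ℝ φ (x + t • v))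
      (fderiv ℝ (fderiv ℝ φ) x v) 0 := h3.comp_hasDerivAt (0 : ℝ) h1
  exact ((ContinuousLinearMap.apply ℝ ℝ v).hasFDerivAt.comp_hasDerivAt (0 : ℝ) h4).deriv

lemma deriv_line {n : ℕ} {φ : Euc n → ℝ} {x : Euc n} (hφ : ContDiffAt ℝ 2 φ x)
    (v : Euc n) : deriv (fun t : ℝ => φ (x + t • v)) 0 = inner ℝ (gradient φ x) v := by
  rw [(deriv_line_eventuallyEq hφ v).self_of_nhds]
  simp [gradient]

/-- The second-derivative test, in the form of a necessary condition. -/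
lemma deriv_deriv_nonneg_of_isLocalMin {f : ℝ → ℝ} {a : ℝ} (hc : ContinuousAt f a)
    (hmin : IsLocalMin f a) : 0 ≤ deriv (deriv f) a := by
  by_contra! hneg
  have hmax := isLocalMax_of_deriv_deriv_neg hneg hmin.deriv_eq_zero hc
  have hconst : f =ᶠ[𝓝 a] fun _ => f a := by
    filter_upwards [hmin, hmax] with x h1 h2 using le_antisymm h2 h1
  have : deriv (deriv f) a = 0 := by
    rw [hconst.deriv.deriv_eq]
    simp
  linarith

lemma lap_nonneg_of_isLocalMin {n : ℕ} {φ : Euc n → ℝ} {x : Euc n} (hφ : ContDiffAt ℝ 2 φ x)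
    (hmin : IsLocalMin φ x) : 0 ≤ lap φ x := by
  rw [lap_eq_sum]
  refine Finset.sum_nonneg fun i _ => ?_
  rw [← deriv_deriv_line hφ]
  have hcont : Continuous (fun t : ℝ => x + t • (EuclideanSpace.single i 1 : Euc n)) := by
    fun_prop
  have hline : Tendsto (fun t : ℝ => x + t • (EuclideanSpace.single i 1 : Euc n))
      (𝓝 0) (𝓝 x) := by
    simpa using hcont.tendsto 0
  apply deriv_deriv_nonneg_of_isLocalMin
  · refine ContinuousAt.comp (g := φ) ?_ hcont.continuousAt
    simpa using hφ.continuousAt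
  · have := hline.eventually hmin
    simpa [IsLocalMin, IsMinFilter] using this

lemma gradient_eq_of_touching {n : ℕ} {φ ψ : Euc n → ℝ} {x : Euc n}
    (hφ : ContDiffAt ℝ 2 φ x) (hψ : ContDiffAt ℝ 2 ψ x)
    (hle : ∀ᶠ y in 𝓝 x, φ y ≤ ψ y) (heq : φ x = ψ x) : gradient φ x = gradient ψ x := by
  have hmin : IsLocalMin (fun y => ψ y - φ y) x := by
    filter_upwards [hle] with y hy
    linarith
  have h0 := hmin.fderiv_eq_zero
  have h1 := fderiv_fun_sub (hψ.differentiableAt (by simp)) (hφ.differentiableAt (by simp))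
  rw [h0] at h1
  rw [gradient, gradient, sub_eq_zero.mp h1.symm]

lemma lap_le_of_touching {n : ℕ} {φ ψ : Euc n → ℝ} {x : Euc n}
    (hφ : ContDiffAt ℝ 2 φ x) (hψ : ContDiffAt ℝ 2 ψ x)
    (hle : ∀ᶠ y in 𝓝 x, φ y ≤ ψ y) (heq : φ x = ψ x) : lap φ x ≤ lap ψ x := by
  have hmin : IsLocalMin (fun y => ψ y + (-1) * φ y) x := by
    filter_upwards [hle] with y hy
    linarith
  have hφ' : ContDiffAt ℝ 2 (fun y => (-1) * φ y) x := contDiffAt_const.mul hφ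
  have := lap_nonneg_of_isLocalMin (hψ.add hφ') hmin
  rw [lap_add hψ hφ', lap_const_mul _ hφ] at this
  linarith

lemma norm_add_smul_single_sub_sq {n : ℕ} (x y : Euc n) (i : Fin n) (t : ℝ) :
    ‖x + t • (EuclideanSpace.single i 1 : Euc n) - y‖ ^ 2 =
      ‖x - y‖ ^ 2 + 2 * t * (x i - y i) + t ^ 2 := by
  have : x + t • (EuclideanSpace.single i 1 : Euc n) - y =
      (x - y) + t • (EuclideanSpace.single i 1 : Euc n) := by abel
  rw [this, norm_add_sq_real, inner_smul_right, norm_smul]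
  simp [EuclideanSpace.inner_single_right]
  ring

lemma contDiff_norm_sub_sq {n : ℕ} (y : Euc n) {k : WithTop ℕ∞} :
    ContDiff ℝ k (fun x : Euc n => ‖x - y‖ ^ 2) :=
  (contDiff_id.sub contDiff_const).norm_sq ℝ

lemma lap_norm_sub_sq {n : ℕ} (y x : Euc n) : lap (fun z : Euc n => ‖z - y‖ ^ 2) x = 2 * n := by
  rw [lap_eq_sum]
  have h : ∀ i : Fin n, fderiv ℝ (fderiv ℝ (fun z : Euc n => ‖z - y‖ ^ 2)) x
      (EuclideanSpace.single i 1) (EuclideanSpace.single i 1) = 2 := by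
    intro i
    rw [← deriv_deriv_line (contDiff_norm_sub_sq y).contDiffAt]
    simp only [norm_add_smul_single_sub_sq]
    have h1 : deriv (fun t : ℝ => ‖x - y‖ ^ 2 + 2 * t * (x i - y i) + t ^ 2) =
        fun t => 2 * (x i - y i) + 2 * t := by
      funext t
      have : HasDerivAt (fun t : ℝ => ‖x - y‖ ^ 2 + 2 * t * (x i - y i) + t ^ 2)
          (2 * 1 * (x i - y i) + 2 * t) t := by
        have h1 := (((hasDerivAt_id t).const_mul 2).mul_const (x i - y i)).const_add (‖x - y‖ ^ 2)
        have h2 := h1.fun_add (hasDerivAt_pow 2 t)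
        simpa using h2
      rw [this.deriv]
      ring
    rw [h1]
    simp
  simp [h, mul_comm]

/-- The Laplacian of a Gaussian bump centred at `y`. -/
lemma lap_gaussian {n : ℕ} (a : ℝ) (y x : Euc n) :
    lap (fun z : Euc n => Real.exp (-a * ‖z - y‖ ^ 2)) x =
      (4 * a ^ 2 * ‖x - y‖ ^ 2 - 2 * a * n) * Real.exp (-a * ‖x - y‖ ^ 2) := by
  have hC : ContDiff ℝ 2 (fun z : Euc n => Real.exp (-a * ‖z - y‖ ^ 2)) :=
    (contDiff_const.mul (contDiff_norm_sub_sq y)).exp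
  rw [lap_eq_sum]
  have h : ∀ i : Fin n, fderiv ℝ (fderiv ℝ (fun z : Euc n => Real.exp (-a * ‖z - y‖ ^ 2))) x
      (EuclideanSpace.single i 1) (EuclideanSpace.single i 1) =
        (4 * a ^ 2 * (x i - y i) ^ 2 - 2 * a) * Real.exp (-a * ‖x - y‖ ^ 2) := by
    intro i
    rw [← deriv_deriv_line hC.contDiffAt]
    simp only [norm_add_smul_single_sub_sq]
    set q := ‖x - y‖ ^ 2
    set b := x i - y i
    have hg : ∀ t : ℝ, HasDerivAt (fun t : ℝ => Real.exp (-a * (q + 2 * t * b + t ^ 2)))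
        (Real.exp (-a * (q + 2 * t * b + t ^ 2)) * (-a * (2 * b + 2 * t))) t := by
      intro t
      have h1 := ((((hasDerivAt_id t).const_mul 2).mul_const b).const_add q).fun_add
        (hasDerivAt_pow 2 t)
      have h2 := (h1.const_mul (-a)).exp
      simpa using h2
    have h1 : deriv (fun t : ℝ => Real.exp (-a * (q + 2 * t * b + t ^ 2))) =
        fun t => Real.exp (-a * (q + 2 * t * b + t ^ 2)) * (-a * (2 * b + 2 * t)) :=
      funext fun t => (hg t).deriv
    rw [h1]
    have h2 : HasDerivAt (fun t : ℝ => -a * (2 * b + 2 * t)) (-a * (2 * 1)) 0 :=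
      (((hasDerivAt_id (0 : ℝ)).const_mul 2).const_add _).const_mul _
    rw [((hg 0).fun_mul h2).deriv]
    simp
    ring
  have hsum : ‖x - y‖ ^ 2 = ∑ i, (x i - y i) ^ 2 := by
    simp [EuclideanSpace.norm_sq_eq]
  simp only [h]
  rw [← Finset.sum_mul, Finset.sum_sub_distrib, ← Finset.mul_sum, ← hsum]
  simp
  ring

lemma ContDiffAt.continuousAt_gradient {n : ℕ} {φ : Euc n → ℝ} {x : Euc n}
    (hφ : ContDiffAt ℝ 2 φ x) : ContinuousAt (gradient φ) x := by
  have h := (hφ.fderiv_right (m := 1) (by norm_num)).continuousAt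
  exact (InnerProductSpace.toDual ℝ (Euc n)).symm.continuous.continuousAt.comp h

lemma ContDiffAt.continuousAt_lap {n : ℕ} {φ : Euc n → ℝ} {x : Euc n}
    (hφ : ContDiffAt ℝ 2 φ x) : ContinuousAt (lap φ) x := by
  have h := ((hφ.fderiv_right (m := 1) (by norm_num)).fderiv_right (m := 0)
    (by norm_num)).continuousAt
  have : lap φ = fun x => ∑ i, fderiv ℝ (fderiv ℝ φ) x (EuclideanSpace.single i 1)
      (EuclideanSpace.single i 1) := funext fun x => lap_eq_sum φ x
  rw [this]
  fun_prop

/-- The geometric hypotheses on the decomposition `Ω = Ωm ∪ Ωp ∪ Γ` that make sense for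
arbitrary boundaries. -/
structure IsDecomposition {n : ℕ} (Ω Ωp Ωm Γ : Set (Euc n)) : Prop where
  isOpen : IsOpen Ω
  isBounded : Bornology.IsBounded Ω
  isOpen_plus : IsOpen Ωp
  plus_subset : Ωp ⊆ Ω
  minus_eq : Ωm = Ω \ closure Ωp
  interface_eq : Γ = Ω \ (Ωp ∪ Ωm)
  interface_eq_minus : Γ = frontier Ωm ∩ Ω
  interface_eq_plus : Γ = frontier Ωp ∩ Ω

/-- The pair (gradient norm, Laplacian) satisfies the sub-solution condition at `x`. -/
def Admissible {n : ℕ} (Ωp Ωm Γ : Set (Euc n)) (x : Euc n) (p l : ℝ) : Prop :=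
  (x ∈ Ωm → p ≤ 1) ∧ (x ∈ Ωp → -2 ≤ l) ∧ (x ∈ Γ → p ≤ 1 ∨ -2 ≤ l)

/-- The viscosity sub-solution condition at a point. -/
def SubAt {n : ℕ} (Ωp Ωm Γ : Set (Euc n)) (w : Euc n → ℝ) (x : Euc n) : Prop :=
  ∀ φ : Euc n → ℝ, ContDiffAt ℝ 2 φ x → (∀ᶠ y in 𝓝 x, w y ≤ φ y) → w x = φ x →
    Admissible Ωp Ωm Γ x ‖gradient φ x‖ (lap φ x)

/-- The family of nonnegative continuous sub-solutions used in the Perron method. -/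
def subClass {n : ℕ} (Ω Ωp Ωm Γ : Set (Euc n)) : Set (Euc n → ℝ) :=
  {w | Continuous w ∧ (∀ x, 0 ≤ w x) ∧ (∀ x, x ∉ Ω → w x = 0) ∧ ∀ x ∈ Ω, SubAt Ωp Ωm Γ w x}

/-- The upper envelope of the Perron family. -/
def perron {n : ℕ} (Ω Ωp Ωm Γ : Set (Euc n)) (x : Euc n) : ℝ :=
  ⨆ w : subClass Ω Ωp Ωm Γ, (w : Euc n → ℝ) x

section

variable {n : ℕ} {Ω Ωp Ωm Γ : Set (Euc n)}

namespace IsDecomposition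

lemma isOpen_minus (h : IsDecomposition Ω Ωp Ωm Γ) : IsOpen Ωm := by
  rw [h.minus_eq]
  exact h.isOpen.sdiff isClosed_closure

lemma minus_subset (h : IsDecomposition Ω Ωp Ωm Γ) : Ωm ⊆ Ω := by
  rw [h.minus_eq]
  exact sdiff_subset

lemma mem_cases (h : IsDecomposition Ω Ωp Ωm Γ) {x : Euc n} (hx : x ∈ Ω) :
    x ∈ Ωm ∨ x ∈ Ωp ∨ x ∈ Γ := by
  rw [h.interface_eq]
  by_cases h1 : x ∈ Ωm
  · exact Or.inl h1
  by_cases h2 : x ∈ Ωp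
  · exact Or.inr (Or.inl h2)
  exact Or.inr (Or.inr ⟨hx, by simp [h1, h2]⟩)

lemma frontier_minus_or_not_mem (h : IsDecomposition Ω Ωp Ωm Γ) {x : Euc n} (hx : x ∉ Ωp) :
    x ∈ closure Ωm ∨ x ∉ Ω := by
  by_cases hΩ : x ∈ Ω
  · left
    rcases h.mem_cases hΩ with h1 | h1 | h1
    · exact subset_closure h1
    · exact absurd h1 hx
    · rw [h.interface_eq_minus] at h1
      exact frontier_subset_closure h1.1
  · exact Or.inr hΩ

lemma notMem_minus_of_plus (h : IsDecomposition Ω Ωp Ωm Γ) {x : Euc n} (hx : x ∈ Ωp) :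
    x ∉ Ωm := by
  rw [h.minus_eq]
  exact fun h' => h'.2 (subset_closure hx)

lemma notMem_interface_of_plus (h : IsDecomposition Ω Ωp Ωm Γ) {x : Euc n} (hx : x ∈ Ωp) :
    x ∉ Γ := by
  rw [h.interface_eq]
  exact fun h' => h'.2 (Or.inl hx)

lemma notMem_interface_of_minus (h : IsDecomposition Ω Ωp Ωm Γ) {x : Euc n} (hx : x ∈ Ωm) :
    x ∉ Γ := by
  rw [h.interface_eq]
  exact fun h' => h'.2 (Or.inr hx)

lemma admissible_iff_of_plus (h : IsDecomposition Ω Ωp Ωm Γ) {x : Euc n} (hx : x ∈ Ωp)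
    {p l : ℝ} : Admissible Ωp Ωm Γ x p l ↔ -2 ≤ l := by
  simp [Admissible, hx, h.notMem_minus_of_plus hx, h.notMem_interface_of_plus hx]

lemma admissible_iff_of_minus (h : IsDecomposition Ω Ωp Ωm Γ) {x : Euc n} (hx : x ∈ Ωm)
    {p l : ℝ} : Admissible Ωp Ωm Γ x p l ↔ p ≤ 1 := by
  have h2 : x ∉ Ωp := fun h' => h.notMem_minus_of_plus h' hx
  simp [Admissible, hx, h2, h.notMem_interface_of_minus hx]

lemma not_admissible (h : IsDecomposition Ω Ωp Ωm Γ) {x : Euc n} (hx : x ∈ Ω) {p l : ℝ}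
    (hp : 1 < p) (hl : l < -2) : ¬ Admissible Ωp Ωm Γ x p l := by
  rintro ⟨h1, h2, h3⟩
  rcases h.mem_cases hx with hx | hx | hx
  · linarith [h1 hx]
  · linarith [h2 hx]
  · rcases h3 hx with h3 | h3 <;> linarith

end IsDecomposition

lemma Admissible.of_le {x : Euc n} {p l : ℝ} (hp : p ≤ 1) (hl : -2 ≤ l) :
    Admissible Ωp Ωm Γ x p l :=
  ⟨fun _ => hp, fun _ => hl, fun _ => Or.inl hp⟩

lemma SubAt.mono {w₁ w₂ : Euc n → ℝ} {x : Euc n} (h : SubAt Ωp Ωm Γ w₁ x)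
    (hle : ∀ᶠ y in 𝓝 x, w₁ y ≤ w₂ y) (heq : w₁ x = w₂ x) : SubAt Ωp Ωm Γ w₂ x := by
  intro φ hφ hφle hφeq
  refine h φ hφ ?_ (heq.trans hφeq)
  filter_upwards [hle, hφle] with y h1 h2 using h1.trans h2

lemma Admissible.subAt {φ : Euc n → ℝ} {x : Euc n} (hφ : ContDiffAt ℝ 2 φ x) {l : ℝ}
    (h : Admissible Ωp Ωm Γ x ‖gradient φ x‖ l) (hl : l ≤ lap φ x) :
    SubAt Ωp Ωm Γ φ x := by
  intro ψ hψ hle heq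
  have h1 := lap_le_of_touching hφ hψ hle heq
  rw [← gradient_eq_of_touching hφ hψ hle heq]
  obtain ⟨ha, hb, hc⟩ := h
  refine ⟨ha, fun hx => by linarith [hb hx], fun hx => ?_⟩
  rcases hc hx with h' | h'
  · exact Or.inl h'
  · exact Or.inr (by linarith)

lemma gradient_add_const (φ : Euc n → ℝ) (c : ℝ) (x : Euc n) :
    gradient (fun y => φ y + c) x = gradient φ x := by
  simp [gradient]

lemma lap_add_const (φ : Euc n → ℝ) (c : ℝ) (x : Euc n) :
    lap (fun y => φ y + c) x = lap φ x := by
  have : fderiv ℝ (fun y => φ y + c) = fderiv ℝ φ := funext fun y => fderiv_add_const c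
  rw [lap_eq_sum, lap_eq_sum, this]

lemma SubAt.admissible_of_isLocalMax {w φ : Euc n → ℝ} {x : Euc n} (h : SubAt Ωp Ωm Γ w x)
    (hφ : ContDiffAt ℝ 2 φ x) (hmax : ∀ᶠ y in 𝓝 x, w y - φ y ≤ w x - φ x) :
    Admissible Ωp Ωm Γ x ‖gradient φ x‖ (lap φ x) := by
  have := h (fun y => φ y + (w x - φ x)) (hφ.add contDiffAt_const)
    (by filter_upwards [hmax] with y hy; linarith) (by ring)
  rwa [gradient_add_const, lap_add_const] at this

/-- Comparison of a viscosity sub-solution with a smooth function violating the sub-solution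
condition everywhere. -/
lemma le_of_not_admissible {D : Set (Euc n)} (hDo : IsOpen D) (hDb : Bornology.IsBounded D)
    {w φ : Euc n → ℝ} (hw : ContinuousOn w (closure D)) (hφ : ContinuousOn φ (closure D))
    (hφ2 : ∀ x ∈ D, ContDiffAt ℝ 2 φ x) (hsub : ∀ x ∈ D, SubAt Ωp Ωm Γ w x)
    (hstrict : ∀ x ∈ D, ¬ Admissible Ωp Ωm Γ x ‖gradient φ x‖ (lap φ x))
    (hbd : ∀ x ∈ frontier D, w x ≤ φ x) : ∀ x ∈ closure D, w x ≤ φ x := by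
  intro x hx
  obtain ⟨x₀, hx₀, hmax⟩ := hDb.isCompact_closure.exists_isMaxOn ⟨x, hx⟩ (hw.sub hφ)
  have hmax' : ∀ y ∈ closure D, w y - φ y ≤ w x₀ - φ x₀ := fun y hy => hmax hy
  by_cases hD : x₀ ∈ D
  · refine absurd ((hsub x₀ hD).admissible_of_isLocalMax (hφ2 x₀ hD) ?_) (hstrict x₀ hD)
    filter_upwards [hDo.mem_nhds hD] with y hy using hmax' y (subset_closure hy)
  · have : x₀ ∈ frontier D := by
      rw [hDo.frontier_eq]
      exact ⟨hx₀, hD⟩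
    linarith [hmax' x hx, hbd x₀ this]

/-- Gluing a local sub-solution into a member of the Perron family. -/
lemma exists_mem_subClass_glue {w v : Euc n → ℝ} (hw : w ∈ subClass Ω Ωp Ωm Γ)
    {D : Set (Euc n)} (hDo : IsOpen D) (hDΩ : D ⊆ Ω) (hv : ContinuousOn v (closure D))
    (hfr : ∀ x ∈ frontier D, v x ≤ w x) (hsub : ∀ x ∈ D, SubAt Ωp Ωm Γ v x) :
    ∃ w' ∈ subClass Ω Ωp Ωm Γ, (∀ x, w x ≤ w' x) ∧ ∀ x ∈ D, v x ≤ w' x := by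
  classical
  obtain ⟨hwc, hw0, hwΩ, hws⟩ := hw
  set w' : Euc n → ℝ := fun x => if x ∈ D then max (w x) (v x) else w x with hw'
  have hle : ∀ x, w x ≤ w' x := by
    intro x
    by_cases hx : x ∈ D <;> simp [hw', hx]
  have hlev : ∀ x ∈ D, v x ≤ w' x := by
    intro x hx
    simp [hw', hx]
  refine ⟨w', ⟨?_, fun x => (hw0 x).trans (hle x), ?_, ?_⟩, hle, hlev⟩
  · refine continuous_if (p := fun x => x ∈ D) ?_ ?_ hwc.continuousOn
    · intro x hx
      exact max_eq_left (hfr x hx)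
    · exact hwc.continuousOn.sup hv
  · intro x hx
    have : x ∉ D := fun h => hx (hDΩ h)
    simp [hw', this, hwΩ x hx]
  · intro x hx
    by_cases hxw : w x = w' x
    · exact (hws x hx).mono (Eventually.of_forall hle) hxw
    · have hxD : x ∈ D := by
        by_contra hxD
        exact hxw (by simp [hw', hxD])
      refine (hsub x hxD).mono ?_ ?_
      · filter_upwards [hDo.mem_nhds hxD] with y hy using hlev y hy
      · simp only [hw', hxD, if_true] at hxw ⊢
        rcases max_choice (w x) (v x) with h | h
        · exact absurd h.symm hxw
        · exact h.symm

lemma zero_mem_subClass : (fun _ => 0) ∈ subClass Ω Ωp Ωm Γ := by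
  refine ⟨continuous_const, fun _ => le_rfl, fun _ _ => rfl, fun x _ => ?_⟩
  refine Admissible.subAt (l := 0) contDiffAt_const (Admissible.of_le ?_ (by norm_num)) ?_
  · simp [gradient]
  · rw [lap_const]

lemma max_mem_subClass {w₁ w₂ : Euc n → ℝ} (h₁ : w₁ ∈ subClass Ω Ωp Ωm Γ)
    (h₂ : w₂ ∈ subClass Ω Ωp Ωm Γ) : (fun x => max (w₁ x) (w₂ x)) ∈ subClass Ω Ωp Ωm Γ := by
  refine ⟨h₁.1.max h₂.1, fun x => (h₁.2.1 x).trans (le_max_left _ _), fun x hx => ?_,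
    fun x hx => ?_⟩
  · simp [h₁.2.2.1 x hx, h₂.2.2.1 x hx]
  · rcases max_choice (w₁ x) (w₂ x) with h | h
    · exact (h₁.2.2.2 x hx).mono (Eventually.of_forall fun y => le_max_left _ _) h.symm
    · exact (h₂.2.2.2 x hx).mono (Eventually.of_forall fun y => le_max_right _ _) h.symm

instance : Nonempty (subClass Ω Ωp Ωm Γ) := ⟨⟨_, zero_mem_subClass⟩⟩

lemma inner_gradient_eq_of_hasDerivAt {φ : Euc n → ℝ} {x v : Euc n} (hφ : ContDiffAt ℝ 2 φ x)
    {d : ℝ} (h : HasDerivAt (fun t : ℝ => φ (x + t • v)) d 0) :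
    inner ℝ (gradient φ x) v = d := by
  rw [← deriv_line hφ, h.deriv]

end

section

variable {n : ℕ} {Ω Ωp Ωm Γ : Set (Euc (n + 1))}

/-- The Perron family is uniformly bounded. -/
lemma exists_bound_subClass (h : IsDecomposition Ω Ωp Ωm Γ) :
    ∃ M : ℝ, 0 ≤ M ∧ ∀ w ∈ subClass Ω Ωp Ωm Γ, ∀ x, w x ≤ M := by
  obtain ⟨R, hR0, hR⟩ := h.isBounded.exists_pos_norm_le
  set z : Euc (n + 1) := EuclideanSpace.single 0 (R + 1) with hz
  have hzn : ‖z‖ = R + 1 := by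
    simpa [hz] using abs_of_nonneg (by linarith : 0 ≤ R + 1)
  have hfar : ∀ x ∈ Ω, 1 ≤ ‖x - z‖ := by
    intro x hx
    have := norm_sub_norm_le z x
    rw [norm_sub_rev] at this
    linarith [hR x hx]
  have hnear : ∀ x ∈ closure Ω, ‖x - z‖ ≤ 2 * R + 1 := by
    intro x hx
    have hcl : IsClosed {x : Euc (n + 1) | ‖x - z‖ ≤ 2 * R + 1} :=
      isClosed_le (by fun_prop) continuous_const
    refine closure_minimal (fun y hy => ?_) hcl hx
    have := norm_sub_le y z
    simp only [mem_ofPred_eq]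
    linarith [hR y hy]
  set C : ℝ := 2 * (2 * R + 1) ^ 2 with hC
  have hC0 : 0 ≤ C := by positivity
  refine ⟨C, hC0, fun w hw x => ?_⟩
  set φ : Euc (n + 1) → ℝ := fun y => C + (-2) * ‖y - z‖ ^ 2 with hφ
  have hq : ContDiff ℝ 2 (fun y : Euc (n + 1) => (-2) * ‖y - z‖ ^ 2) :=
    contDiff_const.mul (contDiff_norm_sub_sq z)
  have hφC : ContDiff ℝ 2 φ := contDiff_const.add hq
  by_cases hx : x ∈ Ω
  · have key := le_of_not_admissible (Ωp := Ωp) (Ωm := Ωm) (Γ := Γ) h.isOpen h.isBounded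
      hw.1.continuousOn hφC.continuous.continuousOn (fun y _ => hφC.contDiffAt) hw.2.2.2 ?_ ?_ x
      (subset_closure hx)
    · have : 0 ≤ ‖x - z‖ ^ 2 := by positivity
      simp only [hφ] at key
      linarith
    · intro y hy
      apply h.not_admissible hy
      · have hd : HasDerivAt (fun t : ℝ => φ (y + t • (y - z))) (-4 * ‖y - z‖ ^ 2) 0 := by
          have heq : (fun t : ℝ => φ (y + t • (y - z))) =
              fun t : ℝ => C + (-2) * ((1 + t) ^ 2 * ‖y - z‖ ^ 2) := by
            funext t
            have : y + t • (y - z) - z = (1 + t) • (y - z) := by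
              rw [add_smul, one_smul]
              abel
            simp only [hφ]
            rw [this, norm_smul, mul_pow, Real.norm_eq_abs, sq_abs]
          rw [heq]
          have h1 : HasDerivAt (fun t : ℝ => (1 + t) ^ 2) (2 * (1 + 0) ^ 1 * 1) 0 := by
            simpa using ((hasDerivAt_id (0 : ℝ)).const_add 1).fun_pow 2
          have h2 := ((h1.mul_const (‖y - z‖ ^ 2)).const_mul (-2)).const_add C
          exact h2.congr_deriv (by ring)
        have h1 := inner_gradient_eq_of_hasDerivAt hφC.contDiffAt hd
        have h2 := abs_real_inner_le_norm (gradient φ y) (y - z)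
        rw [h1, abs_mul, abs_of_nonneg (by positivity : 0 ≤ ‖y - z‖ ^ 2)] at h2
        have h3 := hfar y hy
        norm_num at h2
        nlinarith
      · have : lap φ y = -2 * (2 * (n + 1)) := by
          simp only [hφ]
          rw [lap_add contDiffAt_const hq.contDiffAt, lap_const,
            lap_const_mul _ (contDiff_norm_sub_sq z).contDiffAt, lap_norm_sub_sq]
          push_cast
          ring
        rw [this]
        have : (0 : ℝ) ≤ n := n.cast_nonneg
        linarith
    · intro y hy
      have hyΩ : y ∉ Ω := by
        rw [h.isOpen.frontier_eq] at hy
        exact hy.2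
      rw [hw.2.2.1 y hyΩ]
      have h1 := hnear y (frontier_subset_closure hy)
      have : ‖y - z‖ ^ 2 ≤ (2 * R + 1) ^ 2 := by gcongr
      simp only [hφ, hC]
      linarith
  · rw [hw.2.2.1 x hx]
    exact hC0

lemma bddAbove_subClass (h : IsDecomposition Ω Ωp Ωm Γ) (x : Euc (n + 1)) :
    BddAbove (range fun w : subClass Ω Ωp Ωm Γ => (w : Euc (n + 1) → ℝ) x) := by
  obtain ⟨M, -, hM⟩ := exists_bound_subClass h
  exact ⟨M, by rintro _ ⟨w, rfl⟩; exact hM w w.2 x⟩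

lemma le_perron (h : IsDecomposition Ω Ωp Ωm Γ) {w : Euc (n + 1) → ℝ}
    (hw : w ∈ subClass Ω Ωp Ωm Γ) (x : Euc (n + 1)) : w x ≤ perron Ω Ωp Ωm Γ x :=
  le_ciSup (bddAbove_subClass h x) ⟨w, hw⟩

lemma perron_le {x : Euc (n + 1)} {c : ℝ} (hc : ∀ w ∈ subClass Ω Ωp Ωm Γ, w x ≤ c) :
    perron Ω Ωp Ωm Γ x ≤ c :=
  ciSup_le fun w => hc w w.2

lemma exists_lt_of_lt_perron {x : Euc (n + 1)} {c : ℝ} (hc : c < perron Ω Ωp Ωm Γ x) :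
    ∃ w ∈ subClass Ω Ωp Ωm Γ, c < w x := by
  obtain ⟨w, hw⟩ := exists_lt_of_lt_ciSup hc
  exact ⟨w, w.2, hw⟩

lemma exists_mem_lt_on_compact {K : Set (Euc (n + 1))} (hK : IsCompact K)
    {f : Euc (n + 1) → ℝ} (hf : Continuous f) (hlt : ∀ x ∈ K, f x < perron Ω Ωp Ωm Γ x) :
    ∃ w ∈ subClass Ω Ωp Ωm Γ, ∀ x ∈ K, f x < w x := by
  set V : subClass Ω Ωp Ωm Γ → Set (Euc (n + 1)) :=
    fun w => {x | f x < (w : Euc (n + 1) → ℝ) x} with hV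
  have hcov : K ⊆ ⋃ w, V w := by
    intro x hx
    obtain ⟨w, hw, hwlt⟩ := exists_lt_of_lt_perron (hlt x hx)
    exact mem_iUnion.mpr ⟨⟨w, hw⟩, hwlt⟩
  have hdir : Directed (· ⊆ ·) V := by
    intro w₁ w₂
    exact ⟨⟨_, max_mem_subClass w₁.2 w₂.2⟩,
      fun x hx => lt_of_lt_of_le (b := w₁.1 x) hx (le_max_left _ _),
      fun x hx => lt_of_lt_of_le (b := w₂.1 x) hx (le_max_right _ _)⟩
  obtain ⟨w, hw⟩ := hK.elim_directed_cover V (fun w => isOpen_lt hf w.2.1) hcov hdir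
  exact ⟨w, w.2, hw⟩

lemma perron_eq_zero (h : IsDecomposition Ω Ωp Ωm Γ) {x : Euc (n + 1)} (hx : x ∉ Ω) :
    perron Ω Ωp Ωm Γ x = 0 :=
  le_antisymm (perron_le fun _ hw => (hw.2.2.1 x hx).le) (le_perron h zero_mem_subClass x)

end

section

variable {n : ℕ} {Ω Ωp Ωm Γ : Set (Euc (n + 1))}

/-- A member of the Perron family has one-sided slope at most `2` at points of `Ωm`. -/
lemma eventually_le_add_two_mul (h : IsDecomposition Ω Ωp Ωm Γ) {w : Euc (n + 1) → ℝ}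
    (hw : w ∈ subClass Ω Ωp Ωm Γ) {y : Euc (n + 1)} (hy : y ∈ Ωm) :
    ∀ᶠ x in 𝓝 y, w x ≤ w y + 2 * ‖x - y‖ := by
  obtain ⟨M, hM0, hM⟩ := exists_bound_subClass h
  obtain ⟨r, hr, hball⟩ := Metric.isOpen_iff.mp h.isOpen_minus y hy
  set K : ℝ := M / r ^ 2 with hK
  have hK0 : 0 ≤ K := by positivity
  have hKr : K * r ^ 2 = M := by rw [hK]; field_simp
  set φ : Euc (n + 1) → ℝ := fun x => w y + 3 / 2 * ‖x - y‖ + K * ‖x - y‖ ^ 2 with hφ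
  have hφc : Continuous φ := by fun_prop
  set D : Set (Euc (n + 1)) := ball y r \ {y} with hD
  have hDo : IsOpen D := isOpen_ball.sdiff isClosed_singleton
  have hDm : D ⊆ Ωm := fun x hx => hball hx.1
  have hφ2 : ∀ x ∈ D, ContDiffAt ℝ 2 φ x := by
    intro x hx
    have hne : x - y ≠ 0 := sub_ne_zero.mpr hx.2
    have h1 : ContDiffAt ℝ 2 (fun x : Euc (n + 1) => ‖x - y‖) x :=
      (contDiffAt_norm ℝ hne).comp x (contDiffAt_id.sub contDiffAt_const)
    exact (contDiffAt_const.add (contDiffAt_const.mul h1)).add (contDiffAt_const.mul (h1.pow 2))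
  have key := le_of_not_admissible (Ωp := Ωp) (Ωm := Ωm) (Γ := Γ) hDo
    (isBounded_ball.subset sdiff_subset) hw.1.continuousOn hφc.continuousOn hφ2
    (fun x hx => hw.2.2.2 x (h.minus_subset (hDm hx))) ?_ ?_
  · filter_upwards [ball_mem_nhds y (lt_min hr (by positivity : 0 < 1 / (2 * (K + 1))))]
      with x hx
    rw [mem_ball, lt_min_iff, dist_eq_norm] at hx
    by_cases hxy : x = y
    · simp [hxy]
    have h1 := key x (subset_closure ⟨by rw [mem_ball, dist_eq_norm]; exact hx.1, hxy⟩)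
    have h2 : K * ‖x - y‖ ≤ 1 / 2 := by
      have h3 := hx.2.le
      rw [le_div_iff₀ (by positivity)] at h3
      nlinarith [norm_nonneg (x - y)]
    simp only [hφ] at h1
    nlinarith [norm_nonneg (x - y)]
  · intro x hx
    rw [h.admissible_iff_of_minus (hDm hx), not_le]
    have hpos : 0 < ‖x - y‖ := norm_pos_iff.mpr (sub_ne_zero.mpr hx.2)
    have hd : HasDerivAt (fun t : ℝ => φ (x + t • (x - y)))
        (3 / 2 * ‖x - y‖ + 2 * K * ‖x - y‖ ^ 2) 0 := by
      have h1 : HasDerivAt (fun t : ℝ => 1 + t) 1 0 := (hasDerivAt_id (0 : ℝ)).const_add 1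
      have h2 := ((h1.mul_const (3 / 2 * ‖x - y‖)).add
        ((h1.fun_pow 2).mul_const (K * ‖x - y‖ ^ 2))).const_add (w y)
      refine (h2.congr_deriv (by norm_num; ring)).congr_of_eventuallyEq ?_
      filter_upwards [Ioi_mem_nhds (show (-1 : ℝ) < 0 by norm_num)] with t ht
      have h3 : x + t • (x - y) - y = (1 + t) • (x - y) := by
        rw [add_smul, one_smul]
        abel
      have h4 : 0 ≤ 1 + t := by linarith [mem_Ioi.mp ht]
      simp only [hφ, Pi.add_apply]
      rw [h3, norm_smul, Real.norm_eq_abs, abs_of_nonneg h4]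
      ring
    have h1 := inner_gradient_eq_of_hasDerivAt (hφ2 x hx) hd
    have h2 := real_inner_le_norm (gradient φ x) (x - y)
    rw [h1] at h2
    have h3 : 0 ≤ 2 * K * ‖x - y‖ ^ 2 := by positivity
    by_contra! h4
    nlinarith
  · intro x hx
    rw [hDo.frontier_eq] at hx
    have h1 : x ∈ closedBall y r :=
      closure_minimal (sdiff_subset.trans ball_subset_closedBall) isClosed_closedBall hx.1
    by_cases hxy : x = y
    · simp [hφ, hxy]
    · have h2 : r ≤ ‖x - y‖ := by
        by_contra! h2
        exact hx.2 ⟨by rwa [mem_ball, dist_eq_norm], hxy⟩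
      have h3 : K * r ^ 2 ≤ K * ‖x - y‖ ^ 2 := by gcongr
      have h4 := hM w hw x
      have h5 := hw.2.1 y
      simp only [hφ]
      nlinarith [norm_nonneg (x - y)]

/-- Lipschitz estimate for members of the Perron family along images of convex sets. -/
lemma le_add_mul_of_convex (h : IsDecomposition Ω Ωp Ωm Γ) {w : Euc (n + 1) → ℝ}
    (hw : w ∈ subClass Ω Ωp Ωm Γ) {C : Set (Euc (n + 1))} (hC : Convex ℝ C)
    {F : Euc (n + 1) → Euc (n + 1)} {K : NNReal} (hF : LipschitzOnWith K F C)
    (hmaps : ∀ x ∈ C, F x ∈ Ωm) {a b : Euc (n + 1)} (ha : a ∈ C) (hb : b ∈ C) :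
    w (F a) ≤ w (F b) + 2 * K * ‖a - b‖ := by
  set γ : ℝ → Euc (n + 1) := fun t => F (b + t • (a - b)) with hγ
  have hseg : ∀ t ∈ Icc (0 : ℝ) 1, b + t • (a - b) ∈ C :=
    fun t ht => hC.add_smul_sub_mem hb ha ht
  have hLip : ∀ s ∈ Icc (0 : ℝ) 1, ∀ t ∈ Icc (0 : ℝ) 1,
      ‖γ s - γ t‖ ≤ K * ‖a - b‖ * |s - t| := by
    intro s hs t ht
    have h1 := hF.norm_sub_le (hseg s hs) (hseg t ht)
    have h2 : b + s • (a - b) - (b + t • (a - b)) = (s - t) • (a - b) := by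
      rw [sub_smul]
      abel
    rw [h2, norm_smul, Real.norm_eq_abs] at h1
    linarith
  have hγc : ContinuousOn γ (Icc 0 1) :=
    hF.continuousOn.comp (by fun_prop) hseg
  have hend := image_le_of_liminf_slope_right_le_deriv_boundary (f := fun t => w (γ t))
    (a := 0) (b := 1) (B := fun t => w (γ 0) + 2 * (K * ‖a - b‖) * t)
    (B' := fun _ => 2 * (K * ‖a - b‖)) (hw.1.comp_continuousOn hγc) (by simp) (by fun_prop)
    (fun t _ => by
      simpa using (((hasDerivAt_id t).const_mul (2 * (K * ‖a - b‖))).const_add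
        (w (γ 0))).hasDerivWithinAt) ?_ (right_mem_Icc.mpr zero_le_one)
  · simp only [hγ, one_smul, zero_smul, add_zero, mul_one, add_sub_cancel] at hend
    linarith
  · intro t ht r hr
    refine Eventually.frequently ?_
    have hIcc : Icc (0 : ℝ) 1 ∈ 𝓝[>] t :=
      mem_of_superset (Ioc_mem_nhdsGT ht.2) fun s hs => ⟨ht.1.trans hs.1.le, hs.2⟩
    have htI : t ∈ Icc (0 : ℝ) 1 := ⟨ht.1, ht.2.le⟩
    have hcont : Tendsto γ (𝓝[>] t) (𝓝 (γ t)) := by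
      have := (hγc t htI).mono_left (nhdsWithin_le_iff.mpr hIcc)
      exact this
    filter_upwards [hcont.eventually
      (eventually_le_add_two_mul h hw (hmaps _ (hseg t htI))), hIcc,
      self_mem_nhdsWithin] with s hs hsI hst
    have hst' : 0 < s - t := sub_pos.mpr hst
    have h1 := hLip s hsI t htI
    rw [abs_of_pos hst'] at h1
    refine lt_of_le_of_lt ?_ hr
    rw [slope_def_field, div_le_iff₀ hst']
    simp only [hγ] at hs h1 ⊢
    linarith

/-- Members of the Perron family are equi-Lipschitz near every point of the closure of `Ωm`. -/
lemma exists_nhds_lipschitz (h : IsDecomposition Ω Ωp Ωm Γ) (hLip : UnifLipschitzBoundary Ωm)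
    {ξ : Euc (n + 1)} (hξ : ξ ∈ closure Ωm) :
    ∃ U : Set (Euc (n + 1)), IsOpen U ∧ ξ ∈ U ∧ ∃ L : ℝ, 0 ≤ L ∧ ∀ w ∈ subClass Ω Ωp Ωm Γ,
      ∀ x ∈ U ∩ Ωm, ∀ y ∈ U ∩ Ωm, w x ≤ w y + L * ‖x - y‖ := by
  by_cases hξm : ξ ∈ Ωm
  · obtain ⟨r, hr, hball⟩ := Metric.isOpen_iff.mp h.isOpen_minus ξ hξm
    refine ⟨ball ξ r, isOpen_ball, mem_ball_self hr, 2, by norm_num, ?_⟩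
    intro w hw x hx y hy
    simpa using le_add_mul_of_convex h hw (convex_ball ξ r)
      (LipschitzWith.id.lipschitzOnWith (s := ball ξ r)) (fun z hz => hball hz) hx.1 hy.1
  · have hξf : ξ ∈ frontier Ωm := by
      rw [h.isOpen_minus.frontier_eq]
      exact ⟨hξ, hξm⟩
    obtain ⟨K, -, hK⟩ := hLip
    obtain ⟨Φ, Ψ, U, hUo, hξU, -, -, hΦ, hΨ, hΨΦ, -, -, hpos, -⟩ := hK ξ hξf
    refine ⟨U, hUo, hξU, 2 * K * K, by positivity, ?_⟩
    intro w hw x hx y hy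
    obtain ⟨a, ha, hax⟩ := hpos.symm ▸ hx
    obtain ⟨b, hb, hby⟩ := hpos.symm ▸ hy
    have hconv : Convex ℝ (ball (0 : Euc (n + 1)) 1 ∩ {x | 0 < x (Fin.last n)}) :=
      (convex_ball 0 1).inter
        (convex_halfSpace_gt (EuclideanSpace.proj (𝕜 := ℝ) (Fin.last n)).toLinearMap.isLinear 0)
    have h1 := le_add_mul_of_convex h hw hconv (hΦ.mono inter_subset_left)
      (fun z hz => (hpos ▸ mem_image_of_mem Φ hz : Φ z ∈ U ∩ Ωm).2) ha hb
    have h2 := hΨ.norm_sub_le hx.1 hy.1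
    rw [← hax, ← hby, hΨΦ a ha.1, hΨΦ b hb.1] at h2
    rw [hax, hby] at h1 h2
    have h3 : 2 * (K : ℝ) * ‖a - b‖ ≤ 2 * K * (K * ‖x - y‖) := by gcongr
    linarith

/-- Equicontinuity of the Perron family on the complement of `Ωp`. -/
lemma exists_ball_equicontinuous (h : IsDecomposition Ω Ωp Ωm Γ)
    (hLip : UnifLipschitzBoundary Ωm) {ξ : Euc (n + 1)} (hξ : ξ ∉ Ωp) {η : ℝ} (hη : 0 < η) :
    ∃ δ > 0, ∀ w ∈ subClass Ω Ωp Ωm Γ, ∀ x ∈ ball ξ δ, x ∉ Ωp → |w x - w ξ| ≤ η := by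
  by_cases hξm : ξ ∈ closure Ωm
  · obtain ⟨U, hUo, hξU, L, hL0, hL⟩ := exists_nhds_lipschitz h hLip hξm
    have hcl : ∀ w ∈ subClass Ω Ωp Ωm Γ, ∀ x ∈ U ∩ closure Ωm, ∀ y ∈ U ∩ closure Ωm,
        w x ≤ w y + L * ‖x - y‖ := by
      intro w hw x hx y hy
      have hx' := hUo.inter_closure hx
      have hy' := hUo.inter_closure hy
      have hwc := hw.1
      have hS : IsClosed {p : Euc (n + 1) × Euc (n + 1) |
          w p.1 ≤ w p.2 + L * ‖p.1 - p.2‖} :=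
        isClosed_le (by fun_prop) (by fun_prop)
      have hsub : (U ∩ Ωm) ×ˢ (U ∩ Ωm) ⊆ {p : Euc (n + 1) × Euc (n + 1) |
          w p.1 ≤ w p.2 + L * ‖p.1 - p.2‖} := fun p hp => hL w hw p.1 hp.1 p.2 hp.2
      have := closure_minimal hsub hS
      rw [closure_prod_eq] at this
      exact this (show (x, y) ∈ _ from ⟨hx', hy'⟩)
    have habs : ∀ w ∈ subClass Ω Ωp Ωm Γ, ∀ x ∈ U ∩ closure Ωm, |w x - w ξ| ≤ L * ‖x - ξ‖ := by
      intro w hw x hx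
      have h1 := hcl w hw x hx ξ ⟨hξU, hξm⟩
      have h2 := hcl w hw ξ ⟨hξU, hξm⟩ x hx
      rw [norm_sub_rev] at h2
      exact abs_le.mpr ⟨by linarith, by linarith⟩
    obtain ⟨r, hr, hrU⟩ := Metric.isOpen_iff.mp hUo ξ hξU
    have hsmall : ∀ x ∈ ball ξ (min r (η / (L + 1))), L * ‖x - ξ‖ ≤ η := by
      intro x hx
      rw [mem_ball, lt_min_iff, dist_eq_norm] at hx
      have := hx.2.le
      rw [le_div_iff₀ (by positivity)] at this
      nlinarith [norm_nonneg (x - ξ)]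
    have hδ : 0 < min r (η / (L + 1)) := lt_min hr (by positivity)
    by_cases hξΩ : ξ ∈ Ω
    · obtain ⟨r', hr', hrΩ⟩ := Metric.isOpen_iff.mp h.isOpen ξ hξΩ
      refine ⟨min r' (min r (η / (L + 1))), lt_min hr' hδ, fun w hw x hx hxp => ?_⟩
      have hx1 := ball_subset_ball (min_le_left _ _) hx
      have hx2 := ball_subset_ball (min_le_right _ _) hx
      rcases h.frontier_minus_or_not_mem hxp with h1 | h1
      · exact (habs w hw x ⟨hrU (ball_subset_ball (min_le_left _ _) hx2), h1⟩).trans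
          (hsmall x hx2)
      · exact absurd (hrΩ hx1) h1
    · refine ⟨min r (η / (L + 1)), hδ, fun w hw x hx hxp => ?_⟩
      rcases h.frontier_minus_or_not_mem hxp with h1 | h1
      · exact (habs w hw x ⟨hrU (ball_subset_ball (min_le_left _ _) hx), h1⟩).trans
          (hsmall x hx)
      · rw [hw.2.2.1 x h1, hw.2.2.1 ξ hξΩ]
        simpa using hη.le
  · have hξΩ : ξ ∉ Ω := (h.frontier_minus_or_not_mem hξ).resolve_left hξm
    obtain ⟨r, hr, hball⟩ := Metric.isOpen_iff.mp isClosed_closure.isOpen_compl ξ hξm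
    refine ⟨r, hr, fun w hw x hx hxp => ?_⟩
    have h1 := (h.frontier_minus_or_not_mem hxp).resolve_left (hball hx)
    rw [hw.2.2.1 x h1, hw.2.2.1 ξ hξΩ]
    simpa using hη.le

end

section

variable {n : ℕ} {Ω Ωp Ωm Γ : Set (Euc (n + 1))}

/-- A Lipschitz boundary admits exterior balls of comparable size at all small scales. -/
lemma UnifLipschitzBoundary.exists_exterior_ball {A : Set (Euc (n + 1))}
    (hA : UnifLipschitzBoundary A) {ξ : Euc (n + 1)} (hξ : ξ ∈ frontier A) :
    ∃ c > 0, ∃ s₀ > 0, ∀ s : ℝ, 0 < s → s < s₀ →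
      ∃ y : Euc (n + 1), ‖y - ξ‖ ≤ s ∧ ∀ z ∈ A, c * s ≤ ‖z - y‖ := by
  obtain ⟨K, hK0, hK⟩ := hA
  obtain ⟨Φ, Ψ, U, hUo, hξU, hΦ0, hUim, hΦ, hΨ, hΨΦ, -, -, hpos, -⟩ := hK ξ hξ
  obtain ⟨ρ, hρ, hρU⟩ := Metric.isOpen_iff.mp hUo ξ hξU
  have hK0' : (0 : ℝ) < K := hK0
  refine ⟨min 1 (1 / (K : ℝ) ^ 2), lt_min one_pos (by positivity), min (K : ℝ) (ρ / 2),
    lt_min hK0' (by positivity), fun s hs hs₀ => ?_⟩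
  rw [lt_min_iff] at hs₀
  set t : ℝ := s / K with ht
  have ht0 : 0 < t := by positivity
  have htK : K * t = s := by rw [ht]; field_simp
  have ht1 : t < 1 := by rw [ht, div_lt_one hK0']; exact hs₀.1
  set e : Euc (n + 1) := EuclideanSpace.single (Fin.last n) (-t) with he
  have hen : ‖e‖ = t := by simp [he, abs_of_pos ht0]
  have heball : e ∈ ball (0 : Euc (n + 1)) 1 := by simpa [hen] using ht1
  have hyU : Φ e ∈ U := hUim ▸ mem_image_of_mem Φ heball
  have hyξ : ‖Φ e - ξ‖ ≤ s := by
    have := hΦ.norm_sub_le heball (mem_ball_self one_pos)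
    rwa [hΦ0, sub_zero, hen, htK] at this
  refine ⟨Φ e, hyξ, fun z hz => ?_⟩
  by_cases hzU : z ∈ U
  · have hzUA : z ∈ U ∩ A := ⟨hzU, hz⟩
    rw [← hpos] at hzUA
    obtain ⟨b, hb, rfl⟩ := hzUA
    have h1 := hΨ.norm_sub_le hzU hyU
    rw [hΨΦ b hb.1, hΨΦ e heball] at h1
    have h2 := PiLp.norm_apply_le (b - e) (Fin.last n)
    have h3 : 0 < b (Fin.last n) := hb.2
    have h4 : (b - e) (Fin.last n) = b (Fin.last n) + t := by simp [he]
    rw [h4, Real.norm_eq_abs, abs_of_pos (by linarith)] at h2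
    have h5 : 1 / (K : ℝ) ^ 2 * s ≤ ‖Φ b - Φ e‖ := by
      have : 1 / (K : ℝ) ^ 2 * s = t / K := by rw [ht]; field_simp
      rw [this, div_le_iff₀ hK0']
      linarith
    exact le_trans (by gcongr; exact min_le_right _ _) h5
  · have h1 : ρ ≤ ‖z - ξ‖ := by
      by_contra! h1
      exact hzU (hρU (by rwa [mem_ball, dist_eq_norm]))
    have h2 := norm_sub_le_norm_sub_add_norm_sub z (Φ e) ξ
    have h3 : min 1 (1 / (K : ℝ) ^ 2) * s ≤ 1 * s := by gcongr; exact min_le_left _ _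
    linarith

/-- Superharmonic barriers with a decay factor independent of the scale. -/
lemma UnifLipschitzBoundary.exists_barrier {A : Set (Euc (n + 1))}
    (hA : UnifLipschitzBoundary A) {ξ : Euc (n + 1)} (hξ : ξ ∈ frontier A) :
    ∃ θ : ℝ, 0 ≤ θ ∧ θ < 1 ∧ ∀ ρ > 0, ∃ r > 0, r ≤ ρ ∧ ∃ V : Euc (n + 1) → ℝ,
      ContDiff ℝ 2 V ∧ (∀ x, 0 ≤ V x) ∧ (∀ x, ρ ≤ ‖x - ξ‖ → 1 ≤ V x) ∧
      (∀ x ∈ ball ξ r, V x ≤ θ) ∧ ∀ x ∈ A, lap V x ≤ 0 := by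
  obtain ⟨c, hc, s₀, hs₀, hext⟩ := hA.exists_exterior_ball hξ
  set N : ℝ := n + 1 with hN
  have hN0 : 0 < N := by positivity
  set θ₂ : ℝ := 1 - Real.exp (-(8 * N / c ^ 2)) with hθ₂
  have hθ₂0 : 0 < θ₂ := by
    have : Real.exp (-(8 * N / c ^ 2)) < 1 := Real.exp_lt_one_iff.mpr (by
      have : 0 < 8 * N / c ^ 2 := by positivity
      linarith)
    linarith
  have hθ₁ : Real.exp (-(8 * N / c ^ 2)) < Real.exp (-(2 * N / c ^ 2)) := by
    apply Real.exp_lt_exp.mpr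
    have : 2 * N / c ^ 2 < 8 * N / c ^ 2 := by gcongr; norm_num
    linarith
  have hθ₁' : Real.exp (-(2 * N / c ^ 2)) < 1 := Real.exp_lt_one_iff.mpr (by
    have : 0 < 2 * N / c ^ 2 := by positivity
    linarith)
  refine ⟨(1 - Real.exp (-(2 * N / c ^ 2))) / θ₂, div_nonneg (by linarith) hθ₂0.le, ?_, ?_⟩
  · rw [div_lt_one hθ₂0]
    linarith
  intro ρ hρ
  set s : ℝ := min (s₀ / 2) (ρ / 5) with hs
  have hs0 : 0 < s := lt_min (by positivity) (by positivity)
  have hsρ : s ≤ ρ / 5 := min_le_right _ _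
  have hss₀ : s < s₀ := lt_of_le_of_lt (min_le_left _ _) (by linarith)
  obtain ⟨y, hy, hyA⟩ := hext s hs0 hss₀
  set α : ℝ := N / (2 * c ^ 2 * s ^ 2) with hα
  have hα0 : 0 < α := by positivity
  have hα2 : α * s ^ 2 = N / (2 * c ^ 2) := by rw [hα]; field_simp
  have hgauss : ContDiff ℝ 2 (fun x : Euc (n + 1) => Real.exp (-α * ‖x - y‖ ^ 2)) :=
    (contDiff_const.mul (contDiff_norm_sub_sq y)).exp
  set V : Euc (n + 1) → ℝ := fun x => 1 / θ₂ + (-1 / θ₂) * Real.exp (-α * ‖x - y‖ ^ 2)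
  have hV : ∀ x, V x = (1 - Real.exp (-α * ‖x - y‖ ^ 2)) / θ₂ := fun x => by
    simp only [V]
    ring
  refine ⟨s, hs0, by linarith, V, contDiff_const.add (contDiff_const.mul hgauss), ?_, ?_, ?_, ?_⟩
  · intro x
    have h1 : Real.exp (-α * ‖x - y‖ ^ 2) ≤ 1 := Real.exp_le_one_iff.mpr (by
      have : 0 ≤ α * ‖x - y‖ ^ 2 := by positivity
      linarith)
    rw [hV]
    exact div_nonneg (by linarith) hθ₂0.le
  · intro x hx
    have h1 := norm_sub_le_norm_sub_add_norm_sub x y ξ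
    have h2 : 4 * s ≤ ‖x - y‖ := by linarith
    have h3 : Real.exp (-α * ‖x - y‖ ^ 2) ≤ Real.exp (-(8 * N / c ^ 2)) := by
      apply Real.exp_le_exp.mpr
      have h4 : α * (4 * s) ^ 2 ≤ α * ‖x - y‖ ^ 2 := by gcongr
      have h5 : α * (4 * s) ^ 2 = 8 * N / c ^ 2 := by
        rw [mul_pow, mul_left_comm, hα2]
        field_simp
        norm_num
      linarith
    rw [hV, le_div_iff₀ hθ₂0]
    linarith
  · intro x hx
    rw [mem_ball, dist_eq_norm] at hx
    have h1 := norm_sub_le_norm_sub_add_norm_sub x ξ y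
    rw [norm_sub_rev ξ y] at h1
    have h2 : ‖x - y‖ ≤ 2 * s := by linarith
    have h3 : Real.exp (-(2 * N / c ^ 2)) ≤ Real.exp (-α * ‖x - y‖ ^ 2) := by
      apply Real.exp_le_exp.mpr
      have h4 : α * ‖x - y‖ ^ 2 ≤ α * (2 * s) ^ 2 := by gcongr
      have h5 : α * (2 * s) ^ 2 = 2 * N / c ^ 2 := by
        rw [mul_pow, mul_left_comm, hα2]
        field_simp
      linarith
    rw [hV]
    gcongr
  · intro x hx
    simp only [V]
    rw [lap_add contDiffAt_const (contDiffAt_const.mul hgauss.contDiffAt), lap_const,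
      lap_const_mul _ hgauss.contDiffAt, lap_gaussian]
    have h1 : (c * s) ^ 2 ≤ ‖x - y‖ ^ 2 := by
      have := hyA x hx
      gcongr
    have h2 : α * (c * s) ^ 2 = N / 2 := by
      rw [mul_pow, mul_left_comm, hα2]
      field_simp
    have h3 : α * (c * s) ^ 2 ≤ α * ‖x - y‖ ^ 2 := by gcongr
    have h4 : 0 ≤ 4 * α ^ 2 * ‖x - y‖ ^ 2 - 2 * α * ((n + 1 : ℕ) : ℝ) := by
      push_cast
      nlinarith
    have h5 := mul_nonneg h4 (Real.exp_pos (-α * ‖x - y‖ ^ 2)).le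
    have h6 : 0 ≤ 1 / θ₂ := by positivity
    have h7 := mul_nonneg h6 h5
    rw [zero_add, neg_div, neg_mul]
    linarith

end

section

variable {n : ℕ} {Ω Ωp Ωm Γ : Set (Euc (n + 1))}

lemma mem_or_of_mem_frontier_inter_ball {A : Set (Euc (n + 1))} (hA : IsOpen A)
    {ξ x : Euc (n + 1)} {r : ℝ} (hx : x ∈ frontier (A ∩ ball ξ r)) :
    ‖x - ξ‖ ≤ r ∧ (x ∉ A ∨ r ≤ ‖x - ξ‖) := by
  rw [(hA.inter isOpen_ball).frontier_eq] at hx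
  have h1 : x ∈ closedBall ξ r :=
    closure_minimal (inter_subset_right.trans ball_subset_closedBall) isClosed_closedBall hx.1
  refine ⟨by rwa [mem_closedBall, dist_eq_norm] at h1, ?_⟩
  by_contra! h2
  exact hx.2 ⟨h2.1, by rw [mem_ball, dist_eq_norm]; exact h2.2⟩

/-- Uniform upper semicontinuity of the Perron family at the boundary of `Ωp`. -/
lemma exists_ball_le_add (h : IsDecomposition Ω Ωp Ωm Γ) (hLipM : UnifLipschitzBoundary Ωm)
    (hLipP : UnifLipschitzBoundary Ωp) {ξ : Euc (n + 1)} (hξ : ξ ∈ frontier Ωp) {η : ℝ}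
    (hη : 0 < η) :
    ∃ δ > 0, ∀ w ∈ subClass Ω Ωp Ωm Γ, ∀ x ∈ ball ξ δ, w x ≤ w ξ + 3 * η := by
  obtain ⟨M, hM0, hM⟩ := exists_bound_subClass h
  have hξp : ξ ∉ Ωp := by
    rw [h.isOpen_plus.frontier_eq] at hξ
    exact hξ.2
  obtain ⟨R₀, hR₀, heq⟩ := exists_ball_equicontinuous h hLipM hξp hη
  obtain ⟨θ, hθ0, hθ1, hbar⟩ := hLipP.exists_barrier hξ
  set R : ℝ := min R₀ (min 1 (η / 2)) with hR
  have hR0 : 0 < R := lt_min hR₀ (lt_min one_pos (by positivity))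
  have hRR₀ : R ≤ R₀ := min_le_left _ _
  have hR1 : R ≤ 1 := (min_le_right _ _).trans (min_le_left _ _)
  have hRη : R ≤ η / 2 := (min_le_right _ _).trans (min_le_right _ _)
  have hsq : ∀ x : Euc (n + 1), ‖x - ξ‖ < R → 2 * ‖x - ξ‖ ^ 2 ≤ η := by
    intro x hx
    nlinarith [norm_nonneg (x - ξ)]
  have hoff : ∀ w ∈ subClass Ω Ωp Ωm Γ, ∀ x, ‖x - ξ‖ < R → x ∉ Ωp →
      w x ≤ w ξ + 2 * η - 2 * ‖x - ξ‖ ^ 2 := by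
    intro w hw x hx hxp
    have h1 := heq w hw x (by rw [mem_ball, dist_eq_norm]; linarith) hxp
    linarith [(abs_le.mp h1).2, hsq x hx]
  have claim : ∀ k : ℕ, ∃ ρ > 0, ρ ≤ R ∧ ∀ w ∈ subClass Ω Ωp Ωm Γ, ∀ x ∈ ball ξ ρ,
      w x ≤ w ξ + 2 * η - 2 * ‖x - ξ‖ ^ 2 + M * θ ^ k := by
    intro k
    induction k with
    | zero =>
      refine ⟨R, hR0, le_rfl, fun w hw x hx => ?_⟩
      rw [mem_ball, dist_eq_norm] at hx
      have := hM w hw x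
      have := hw.2.1 ξ
      have := hsq x hx
      rw [pow_zero, mul_one]
      linarith
    | succ k ih =>
      obtain ⟨ρ, hρ, hρR, hk⟩ := ih
      obtain ⟨r, hr, hrρ, V, hVc, hV0, hV1, hVθ, hVlap⟩ := hbar (ρ / 2) (by positivity)
      have hMk : 0 ≤ M * θ ^ k := by positivity
      refine ⟨r, hr, by linarith, fun w hw x hx => ?_⟩
      have hx' := hx
      rw [mem_ball, dist_eq_norm] at hx'
      by_cases hxp : x ∈ Ωp
      swap
      · have h1 := hoff w hw x (by linarith) hxp
        have : 0 ≤ M * θ ^ (k + 1) := by positivity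
        linarith
      have hq : ContDiff ℝ 2 (fun y : Euc (n + 1) => (-2) * ‖y - ξ‖ ^ 2) :=
        contDiff_const.mul (contDiff_norm_sub_sq ξ)
      have hV' : ContDiff ℝ 2 (fun y => M * θ ^ k * V y) := contDiff_const.mul hVc
      set φ : Euc (n + 1) → ℝ :=
        fun y => (w ξ + 2 * η) + ((-2) * ‖y - ξ‖ ^ 2 + M * θ ^ k * V y) with hφ
      have hφc : ContDiff ℝ 2 φ := contDiff_const.add (hq.add hV')
      have key := le_of_not_admissible (Ωp := Ωp) (Ωm := Ωm) (Γ := Γ) (w := w) (φ := φ)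
        (h.isOpen_plus.inter (isOpen_ball (x := ξ) (ε := ρ / 2)))
        (isBounded_ball.subset inter_subset_right) hw.1.continuousOn
        hφc.continuous.continuousOn (fun y _ => hφc.contDiffAt)
        (fun y hy => hw.2.2.2 y (h.plus_subset hy.1)) ?_ ?_ x
        (subset_closure ⟨hxp, ball_subset_ball hrρ hx⟩)
      · have h1 : M * θ ^ k * V x ≤ M * θ ^ k * θ :=
          mul_le_mul_of_nonneg_left (hVθ x hx) hMk
        simp only [hφ] at key
        rw [pow_succ θ, ← mul_assoc]
        linarith
      · intro y hy
        rw [h.admissible_iff_of_plus hy.1, not_le]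
        simp only [hφ]
        rw [lap_add contDiffAt_const (hq.add hV').contDiffAt, lap_const,
          lap_add hq.contDiffAt hV'.contDiffAt, lap_const_mul _ hVc.contDiffAt,
          lap_const_mul _ (contDiff_norm_sub_sq ξ).contDiffAt, lap_norm_sub_sq]
        have h1 := mul_nonneg hMk (neg_nonneg.mpr (hVlap y hy.1))
        have h2 : (0 : ℝ) ≤ n := n.cast_nonneg
        push_cast
        linarith
      · intro y hy
        obtain ⟨h1, h2⟩ := mem_or_of_mem_frontier_inter_ball h.isOpen_plus hy
        simp only [hφ]
        by_cases hyp : y ∈ Ωp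
        · have h3 := hV1 y (h2.resolve_left (fun h' => h' hyp))
          have h4 := hk w hw y (by rw [mem_ball, dist_eq_norm]; linarith)
          have h5 := mul_le_mul_of_nonneg_left h3 hMk
          linarith
        · have h3 := hoff w hw y (by linarith) hyp
          have h4 := mul_nonneg hMk (hV0 y)
          linarith
  obtain ⟨k, hk⟩ := exists_pow_lt_of_lt_one (show 0 < η / (M + 1) by positivity) hθ1
  obtain ⟨ρ, hρ, -, hkρ⟩ := claim k
  refine ⟨ρ, hρ, fun w hw x hx => ?_⟩
  have h1 := hkρ w hw x hx
  have h2 := hk.le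
  rw [le_div_iff₀ (by positivity)] at h2
  have h3 : 0 ≤ θ ^ k := by positivity
  nlinarith [sq_nonneg ‖x - ξ‖]

/-- Uniform lower bound for the Perron envelope at the boundary of `Ωp`. -/
lemma exists_ball_sub_le_perron (h : IsDecomposition Ω Ωp Ωm Γ)
    (hLipM : UnifLipschitzBoundary Ωm) (hLipP : UnifLipschitzBoundary Ωp) {ξ : Euc (n + 1)}
    (hξ : ξ ∈ frontier Ωp) {η : ℝ} (hη : 0 < η) :
    ∃ δ > 0, ∀ w ∈ subClass Ω Ωp Ωm Γ, ∀ x ∈ ball ξ δ,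
      w ξ - 2 * η ≤ perron Ω Ωp Ωm Γ x := by
  obtain ⟨M, hM0, hM⟩ := exists_bound_subClass h
  have hξp : ξ ∉ Ωp := by
    rw [h.isOpen_plus.frontier_eq] at hξ
    exact hξ.2
  obtain ⟨R, hR, heq⟩ := exists_ball_equicontinuous h hLipM hξp hη
  obtain ⟨θ, hθ0, hθ1, hbar⟩ := hLipP.exists_barrier hξ
  have hoff : ∀ w ∈ subClass Ω Ωp Ωm Γ, ∀ x, ‖x - ξ‖ < R → x ∉ Ωp → w ξ - η ≤ w x := by
    intro w hw x hx hxp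
    have h1 := heq w hw x (by rw [mem_ball, dist_eq_norm]; linarith) hxp
    linarith [(abs_le.mp h1).1]
  have claim : ∀ k : ℕ, ∃ ρ > 0, ρ ≤ R ∧ ∀ w ∈ subClass Ω Ωp Ωm Γ,
      ∃ w' ∈ subClass Ω Ωp Ωm Γ, (∀ x, w x ≤ w' x) ∧
        ∀ x ∈ ball ξ ρ, w ξ - η - M * θ ^ k ≤ w' x := by
    intro k
    induction k with
    | zero =>
      refine ⟨R, hR, le_rfl, fun w hw => ⟨w, hw, fun _ => le_rfl, fun x _ => ?_⟩⟩
      have := hM w hw ξ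
      have := hw.2.1 x
      rw [pow_zero, mul_one]
      linarith
    | succ k ih =>
      obtain ⟨ρ, hρ, hρR, hk⟩ := ih
      obtain ⟨r, hr, hrρ, V, hVc, hV0, hV1, hVθ, hVlap⟩ := hbar (ρ / 2) (by positivity)
      have hMk : 0 ≤ M * θ ^ k := by positivity
      refine ⟨r, hr, by linarith, fun w hw => ?_⟩
      obtain ⟨w', hw', hww', hw'k⟩ := hk w hw
      have hV' : ContDiff ℝ 2 (fun y => -(M * θ ^ k) * V y) := contDiff_const.mul hVc
      set v : Euc (n + 1) → ℝ := fun y => (w ξ - η) + -(M * θ ^ k) * V y with hv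
      have hvc : ContDiff ℝ 2 v := contDiff_const.add hV'
      obtain ⟨w'', hw'', hw'w'', hvw''⟩ := exists_mem_subClass_glue hw' (v := v)
        (h.isOpen_plus.inter (isOpen_ball (x := ξ) (ε := ρ / 2)))
        (inter_subset_left.trans h.plus_subset) hvc.continuous.continuousOn
        (fun y hy => by
          obtain ⟨h1, h2⟩ := mem_or_of_mem_frontier_inter_ball h.isOpen_plus hy
          simp only [hv]
          by_cases hyp : y ∈ Ωp
          · have h3 := hV1 y (h2.resolve_left (fun h' => h' hyp))
            have h4 := hw'k y (by rw [mem_ball, dist_eq_norm]; linarith)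
            have h5 := mul_le_mul_of_nonneg_left h3 hMk
            linarith
          · have h3 := hoff w hw y (by linarith) hyp
            have h4 := mul_nonneg hMk (hV0 y)
            linarith [hww' y])
        (fun y hy => by
          refine Admissible.subAt (l := -2) hvc.contDiffAt
            ((h.admissible_iff_of_plus hy.1).mpr le_rfl) ?_
          simp only [hv]
          rw [lap_add contDiffAt_const hV'.contDiffAt, lap_const,
            lap_const_mul _ hVc.contDiffAt]
          have h1 := mul_nonneg hMk (neg_nonneg.mpr (hVlap y hy.1))
          linarith)
      refine ⟨w'', hw'', fun x => (hww' x).trans (hw'w'' x), fun x hx => ?_⟩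
      have hx' := hx
      rw [mem_ball, dist_eq_norm] at hx'
      by_cases hxp : x ∈ Ωp
      · have h1 := hvw'' x ⟨hxp, ball_subset_ball hrρ hx⟩
        have h2 : M * θ ^ k * V x ≤ M * θ ^ k * θ :=
          mul_le_mul_of_nonneg_left (hVθ x hx) hMk
        simp only [hv] at h1
        rw [pow_succ θ, ← mul_assoc]
        linarith
      · have h1 := hoff w hw x (by linarith) hxp
        have : 0 ≤ M * θ ^ (k + 1) := by positivity
        linarith [hww' x, hw'w'' x]
  obtain ⟨k, hk⟩ := exists_pow_lt_of_lt_one (show 0 < η / (M + 1) by positivity) hθ1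
  obtain ⟨ρ, hρ, -, hkρ⟩ := claim k
  refine ⟨ρ, hρ, fun w hw x hx => ?_⟩
  obtain ⟨w', hw', -, hw'k⟩ := hkρ w hw
  have h1 := hw'k x hx
  have h2 := hk.le
  rw [le_div_iff₀ (by positivity)] at h2
  have h3 : 0 ≤ θ ^ k := by positivity
  have h4 := le_perron h hw' x
  nlinarith

/-- Uniform continuity estimates for the Perron family at points outside `Ωp`. -/
lemma exists_ball_perron_estimate (h : IsDecomposition Ω Ωp Ωm Γ)
    (hLipM : UnifLipschitzBoundary Ωm) (hLipP : UnifLipschitzBoundary Ωp) {ξ : Euc (n + 1)}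
    (hξ : ξ ∉ Ωp) {η : ℝ} (hη : 0 < η) :
    ∃ δ > 0, ∀ w ∈ subClass Ω Ωp Ωm Γ, ∀ x ∈ ball ξ δ,
      w x ≤ w ξ + η ∧ w ξ - η ≤ perron Ω Ωp Ωm Γ x := by
  by_cases hξc : ξ ∈ closure Ωp
  · have hξf : ξ ∈ frontier Ωp := by
      rw [h.isOpen_plus.frontier_eq]
      exact ⟨hξc, hξ⟩
    obtain ⟨δ₁, hδ₁, h1⟩ := exists_ball_le_add h hLipM hLipP hξf (show 0 < η / 3 by positivity)
    obtain ⟨δ₂, hδ₂, h2⟩ :=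
      exists_ball_sub_le_perron h hLipM hLipP hξf (show 0 < η / 2 by positivity)
    refine ⟨min δ₁ δ₂, lt_min hδ₁ hδ₂, fun w hw x hx => ⟨?_, ?_⟩⟩
    · linarith [h1 w hw x (ball_subset_ball (min_le_left _ _) hx)]
    · linarith [h2 w hw x (ball_subset_ball (min_le_right _ _) hx)]
  · obtain ⟨δ₁, hδ₁, h1⟩ := exists_ball_equicontinuous h hLipM hξ hη
    obtain ⟨δ₂, hδ₂, h2⟩ := Metric.isOpen_iff.mp isClosed_closure.isOpen_compl ξ hξc
    refine ⟨min δ₁ δ₂, lt_min hδ₁ hδ₂, fun w hw x hx => ?_⟩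
    have hxp : x ∉ Ωp := fun h' =>
      h2 (ball_subset_ball (min_le_right _ _) hx) (subset_closure h')
    have h3 := abs_le.mp (h1 w hw x (ball_subset_ball (min_le_left _ _) hx) hxp)
    exact ⟨by linarith, by linarith [le_perron h hw x]⟩

end

lemma lap_comp_add_right {n : ℕ} (φ : Euc n → ℝ) (e x : Euc n) :
    lap (fun y => φ (y + e)) x = lap φ (x + e) := by
  have h1 : fderiv ℝ (fun y => φ (y + e)) = fun y => fderiv ℝ φ (y + e) :=
    funext fun y => fderiv_comp_add_right e
  have h2 : fderiv ℝ (fun y => fderiv ℝ φ (y + e)) x = fderiv ℝ (fderiv ℝ φ) (x + e) :=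
    fderiv_comp_add_right e
  rw [lap_eq_sum, lap_eq_sum, h1, h2]

section

variable {n : ℕ} {Ω Ωp Ωm Γ : Set (Euc n)}

/-- In `Ωp` the sub-solution condition is invariant under translations. -/
lemma SubAt.comp_add_right (h : IsDecomposition Ω Ωp Ωm Γ) {w : Euc n → ℝ} {x e : Euc n}
    (hx : x ∈ Ωp) (hxe : x + e ∈ Ωp) (hw : SubAt Ωp Ωm Γ w (x + e)) (c : ℝ) :
    SubAt Ωp Ωm Γ (fun y => w (y + e) + c) x := by
  intro φ hφ hle heq
  rw [h.admissible_iff_of_plus hx]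
  have hx' : x + e + -e = x := by abel
  have hφ' : ContDiffAt ℝ 2 (fun y => φ (y + -e)) (x + e) := by
    refine ContDiffAt.comp (x + e) ?_ (contDiffAt_id.add contDiffAt_const)
    simpa [hx'] using hφ
  have htend : Tendsto (fun y : Euc n => y + -e) (𝓝 (x + e)) (𝓝 x) := by
    have : Continuous (fun y : Euc n => y + -e) := by fun_prop
    simpa [hx'] using this.tendsto (x + e)
  have key := hw (fun y => φ (y + -e) + -c) (hφ'.add contDiffAt_const) ?_ ?_
  · rw [h.admissible_iff_of_plus hxe, lap_add_const, lap_comp_add_right φ (-e), hx'] at key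
    exact key
  · filter_upwards [htend.eventually hle] with y hy
    have : y + -e + e = y := by abel
    rw [this] at hy
    linarith
  · simp only [hx']
    linarith

end

section

variable {n : ℕ} {Ω Ωp Ωm Γ : Set (Euc (n + 1))}

lemma continuousAt_perron_of_notMem_plus (h : IsDecomposition Ω Ωp Ωm Γ)
    (hLipM : UnifLipschitzBoundary Ωm) (hLipP : UnifLipschitzBoundary Ωp) {ξ : Euc (n + 1)}
    (hξ : ξ ∉ Ωp) : ContinuousAt (perron Ω Ωp Ωm Γ) ξ := by
  rw [Metric.continuousAt_iff]
  intro η hη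
  obtain ⟨δ, hδ, hest⟩ := exists_ball_perron_estimate h hLipM hLipP hξ (half_pos hη)
  refine ⟨δ, hδ, fun x hx => ?_⟩
  have h1 : perron Ω Ωp Ωm Γ x ≤ perron Ω Ωp Ωm Γ ξ + η / 2 :=
    perron_le fun w hw => (hest w hw x hx).1.trans (by linarith [le_perron h hw ξ])
  have h2 : perron Ω Ωp Ωm Γ ξ ≤ perron Ω Ωp Ωm Γ x + η / 2 :=
    perron_le fun w hw => by linarith [(hest w hw x hx).2]
  rw [Real.dist_eq, abs_lt]
  exact ⟨by linarith, by linarith⟩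

/-- A uniform comparison between the Perron family and its envelope near the boundary of `Ωp`. -/
lemma exists_uniform_perron_estimate (h : IsDecomposition Ω Ωp Ωm Γ)
    (hLipM : UnifLipschitzBoundary Ωm) (hLipP : UnifLipschitzBoundary Ωp) {η : ℝ} (hη : 0 < η) :
    ∃ δ > 0, ∀ ξ ∈ frontier Ωp, ∀ a ∈ ball ξ δ, ∀ b ∈ ball ξ δ, ∀ w ∈ subClass Ω Ωp Ωm Γ,
      w a ≤ perron Ω Ωp Ωm Γ b + 2 * η := by
  have hf : ∀ ξ : frontier Ωp, (ξ : Euc (n + 1)) ∉ Ωp := by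
    rintro ⟨ξ, hξ⟩
    rw [h.isOpen_plus.frontier_eq] at hξ
    exact hξ.2
  choose δ hδ hest using fun ξ : frontier Ωp =>
    exists_ball_perron_estimate h hLipM hLipP (hf ξ) hη
  have hcpt : IsCompact (frontier Ωp) :=
    (h.isBounded.subset h.plus_subset).isCompact_closure.of_isClosed_subset isClosed_frontier
      frontier_subset_closure
  obtain ⟨δ₀, hδ₀, hleb⟩ := lebesgue_number_lemma_of_metric hcpt
    (c := fun ξ : frontier Ωp => ball (ξ : Euc (n + 1)) (δ ξ)) (fun _ => isOpen_ball)
    (fun ξ hξ => mem_iUnion.mpr ⟨⟨ξ, hξ⟩, mem_ball_self (hδ _)⟩)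
  refine ⟨δ₀, hδ₀, fun ξ hξ a ha b hb w hw => ?_⟩
  obtain ⟨ζ, hζ⟩ := hleb ξ hξ
  have h1 := (hest ζ w hw a (hζ ha)).1
  have h2 := (hest ζ w hw b (hζ hb)).2
  linarith

lemma exists_translation_estimate (h : IsDecomposition Ω Ωp Ωm Γ)
    (hLipM : UnifLipschitzBoundary Ωm) (hLipP : UnifLipschitzBoundary Ωp) {η : ℝ} (hη : 0 < η) :
    ∃ δ > 0, ∀ x ∈ Ωp, ∀ y ∈ Ωp, dist x y < δ →
      perron Ω Ωp Ωm Γ y ≤ perron Ω Ωp Ωm Γ x + 3 * η := by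
  obtain ⟨δ, hδ, hest⟩ := exists_uniform_perron_estimate h hLipM hLipP hη
  refine ⟨δ, hδ, fun x hx y hy hxy => perron_le fun w hw => ?_⟩
  obtain ⟨e, rfl⟩ : ∃ e, y = x + e := ⟨y - x, by abel⟩
  have he : ‖e‖ < δ := by simpa using hxy
  have hcont : Continuous (fun z : Euc (n + 1) => z + e) := by fun_prop
  set D : Set (Euc (n + 1)) := Ωp ∩ (fun z => z + e) ⁻¹' Ωp with hD
  have hDo : IsOpen D := h.isOpen_plus.inter (h.isOpen_plus.preimage hcont)
  have hv : Continuous (fun z => w (z + e) + -(3 * η)) :=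
    (hw.1.comp hcont).add continuous_const
  have hcpt : IsCompact (frontier D) :=
    (h.isBounded.subset (inter_subset_left.trans h.plus_subset)).isCompact_closure.of_isClosed_subset
      isClosed_frontier frontier_subset_closure
  obtain ⟨w', hw', hlt⟩ := exists_mem_lt_on_compact (Ω := Ω) (Ωp := Ωp) (Ωm := Ωm) (Γ := Γ)
    hcpt hv (fun z hz => by
      rw [hDo.frontier_eq] at hz
      have hz1 : z ∈ closure Ωp := closure_mono inter_subset_left hz.1
      have hz2 : z + e ∈ closure Ωp :=
        hcont.closure_preimage_subset _ (closure_mono inter_subset_right hz.1)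
      have : w (z + e) ≤ perron Ω Ωp Ωm Γ z + 2 * η := by
        by_cases hzp : z ∈ Ωp
        · have hze : z + e ∉ Ωp := fun h' => hz.2 ⟨hzp, h'⟩
          refine hest (z + e) ?_ (z + e) (mem_ball_self hδ) z ?_ w hw
          · rw [h.isOpen_plus.frontier_eq]
            exact ⟨hz2, hze⟩
          · simpa using he
        · refine hest z ?_ (z + e) ?_ z (mem_ball_self hδ) w hw
          · rw [h.isOpen_plus.frontier_eq]
            exact ⟨hz1, hzp⟩
          · simpa using he
      linarith)
  obtain ⟨w'', hw'', -, hle⟩ := exists_mem_subClass_glue hw' hDo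
    (inter_subset_left.trans h.plus_subset) hv.continuousOn (fun z hz => (hlt z hz).le)
    (fun z hz => SubAt.comp_add_right h hz.1 hz.2 (hw.2.2.2 _ (h.plus_subset hz.2)) _)
  have h1 := hle x ⟨hx, hy⟩
  have h2 := le_perron h hw'' x
  linarith

lemma continuous_perron (h : IsDecomposition Ω Ωp Ωm Γ)
    (hLipM : UnifLipschitzBoundary Ωm) (hLipP : UnifLipschitzBoundary Ωp) :
    Continuous (perron Ω Ωp Ωm Γ) := by
  rw [continuous_iff_continuousAt]
  intro x
  by_cases hx : x ∈ Ωp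
  · rw [Metric.continuousAt_iff]
    intro η hη
    obtain ⟨δ, hδ, hest⟩ := exists_translation_estimate h hLipM hLipP
      (show 0 < η / 4 by positivity)
    obtain ⟨r, hr, hball⟩ := Metric.isOpen_iff.mp h.isOpen_plus x hx
    refine ⟨min δ r, lt_min hδ hr, fun y hy => ?_⟩
    rw [lt_min_iff] at hy
    have hyp : y ∈ Ωp := hball hy.2
    have h1 := hest y hyp x hx hy.1
    have h2 := hest x hx y hyp (by rw [dist_comm]; exact hy.1)
    rw [Real.dist_eq, abs_lt]
    exact ⟨by linarith, by linarith⟩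
  · exact continuousAt_perron_of_notMem_plus h hLipM hLipP hx

end

section

variable {n : ℕ} {Ω Ωp Ωm Γ : Set (Euc n)}

lemma eventually_not_admissible (h : IsDecomposition Ω Ωp Ωm Γ) {φ : Euc n → ℝ} {x : Euc n}
    (hx : x ∈ Ω) (hφ : ContDiffAt ℝ 2 φ x)
    (hna : ¬ Admissible Ωp Ωm Γ x ‖gradient φ x‖ (lap φ x)) :
    ∀ᶠ y in 𝓝 x, ¬ Admissible Ωp Ωm Γ y ‖gradient φ y‖ (lap φ y) := by
  have hg := hφ.continuousAt_gradient.norm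
  have hl := hφ.continuousAt_lap
  rcases h.mem_cases hx with hxm | hxp | hxΓ
  · rw [h.admissible_iff_of_minus hxm, not_le] at hna
    filter_upwards [h.isOpen_minus.mem_nhds hxm, hg.eventually (lt_mem_nhds hna)] with y hy hlt
    rwa [h.admissible_iff_of_minus hy, not_le]
  · rw [h.admissible_iff_of_plus hxp, not_le] at hna
    filter_upwards [h.isOpen_plus.mem_nhds hxp, hl.eventually (gt_mem_nhds hna)] with y hy hlt
    rwa [h.admissible_iff_of_plus hy, not_le]
  · have hxm : x ∉ Ωm := fun h' => h.notMem_interface_of_minus h' hxΓ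
    have hxp : x ∉ Ωp := fun h' => h.notMem_interface_of_plus h' hxΓ
    simp only [Admissible, hxm, hxp, hxΓ, false_imp_iff, true_imp_iff, true_and, not_or,
      not_le] at hna
    filter_upwards [h.isOpen.mem_nhds hx, hg.eventually (lt_mem_nhds hna.1),
      hl.eventually (gt_mem_nhds hna.2)] with y hy h1 h2
    exact h.not_admissible hy h1 h2

lemma eventually_admissible (h : IsDecomposition Ω Ωp Ωm Γ) {φ : Euc n → ℝ} {x : Euc n}
    (hφ : ContDiffAt ℝ 2 φ x)
    (hs : (x ∈ Ωm ∧ ‖gradient φ x‖ < 1) ∨ (x ∈ Ωp ∧ -2 < lap φ x) ∨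
      (‖gradient φ x‖ < 1 ∧ -2 < lap φ x)) :
    ∀ᶠ y in 𝓝 x, Admissible Ωp Ωm Γ y ‖gradient φ y‖ (lap φ y) := by
  have hg := hφ.continuousAt_gradient.norm
  have hl := hφ.continuousAt_lap
  rcases hs with ⟨hx, hs⟩ | ⟨hx, hs⟩ | ⟨hs₁, hs₂⟩
  · filter_upwards [h.isOpen_minus.mem_nhds hx, hg.eventually (gt_mem_nhds hs)] with y hy hlt
    exact (h.admissible_iff_of_minus hy).mpr hlt.le
  · filter_upwards [h.isOpen_plus.mem_nhds hx, hl.eventually (lt_mem_nhds hs)] with y hy hlt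
    exact (h.admissible_iff_of_plus hy).mpr hlt.le
  · filter_upwards [hg.eventually (gt_mem_nhds hs₁), hl.eventually (lt_mem_nhds hs₂)]
      with y h1 h2
    exact Admissible.of_le h1.le h2.le

lemma gradient_add_mul_norm_sub_sq {φ : Euc n → ℝ} {x : Euc n} (hφ : ContDiffAt ℝ 2 φ x)
    (ε : ℝ) : gradient (fun y => φ y + ε * ‖y - x‖ ^ 2) x = gradient φ x := by
  have hψ : ContDiffAt ℝ 2 (fun y => φ y + ε * ‖y - x‖ ^ 2) x :=
    hφ.add (contDiffAt_const.mul (contDiff_norm_sub_sq x).contDiffAt)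
  rcases le_total 0 ε with hε | hε
  · refine (gradient_eq_of_touching hφ hψ (Eventually.of_forall fun y => ?_) (by simp)).symm
    have : 0 ≤ ε * ‖y - x‖ ^ 2 := by positivity
    linarith
  · refine gradient_eq_of_touching hψ hφ (Eventually.of_forall fun y => ?_) (by simp)
    have : ε * ‖y - x‖ ^ 2 ≤ 0 := mul_nonpos_of_nonpos_of_nonneg hε (by positivity)
    linarith

lemma lap_add_mul_norm_sub_sq {φ : Euc n → ℝ} {x : Euc n} (hφ : ContDiffAt ℝ 2 φ x)
    (ε : ℝ) : lap (fun y => φ y + ε * ‖y - x‖ ^ 2) x = lap φ x + ε * (2 * n) := by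
  rw [lap_add hφ (contDiffAt_const.mul (contDiff_norm_sub_sq x).contDiffAt),
    lap_const_mul _ (contDiff_norm_sub_sq x).contDiffAt, lap_norm_sub_sq]

lemma norm_sub_eq_of_mem_frontier_ball {x y : Euc n} {r : ℝ} (hr : 0 < r)
    (hy : y ∈ frontier (ball x r)) : ‖y - x‖ = r := by
  rw [frontier_ball x hr.ne', mem_sphere, dist_eq_norm] at hy
  exact hy

end

section

variable {n : ℕ} {Ω Ωp Ωm Γ : Set (Euc (n + 1))}

lemma subAt_perron (h : IsDecomposition Ω Ωp Ωm Γ) {x : Euc (n + 1)} (hx : x ∈ Ω) :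
    SubAt Ωp Ωm Γ (perron Ω Ωp Ωm Γ) x := by
  intro φ hφ hle heq
  by_contra hna
  obtain ⟨ε, hε, hεl⟩ : ∃ ε > 0, -2 ≤ lap φ x + ε * (2 * ((n + 1 : ℕ) : ℝ)) →
      -2 ≤ lap φ x := by
    by_cases hl : -2 ≤ lap φ x
    · exact ⟨1, one_pos, fun _ => hl⟩
    · rw [not_le] at hl
      have hN : (0 : ℝ) < 2 * ((n + 1 : ℕ) : ℝ) := by positivity
      refine ⟨(-2 - lap φ x) / 2 / (2 * ((n + 1 : ℕ) : ℝ)),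
        div_pos (by linarith) hN, fun h' => ?_⟩
      rw [div_mul_cancel₀ _ hN.ne'] at h'
      linarith
  have hψ : ContDiffAt ℝ 2 (fun y => φ y + ε * ‖y - x‖ ^ 2) x :=
    hφ.add (contDiffAt_const.mul (contDiff_norm_sub_sq x).contDiffAt)
  have hψna := eventually_not_admissible h hx hψ (by
    rw [gradient_add_mul_norm_sub_sq hφ, lap_add_mul_norm_sub_sq hφ]
    rintro ⟨ha, hb, hc⟩
    exact hna ⟨ha, fun hx => hεl (hb hx), fun hx => (hc hx).imp_right hεl⟩)
  have hev := hψna.and ((hψ.eventually (by simp)).and (hle.and (h.isOpen.mem_nhds hx)))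
  obtain ⟨r, hr, hball⟩ := Metric.nhds_basis_closedBall.eventually_iff.mp hev
  have hsub : ball x r ⊆ closedBall x r := ball_subset_closedBall
  have hcl : closure (ball x r) = closedBall x r := closure_ball x hr.ne'
  have hlt : perron Ω Ωp Ωm Γ x ≤ perron Ω Ωp Ωm Γ x - ε * r ^ 2 := by
    refine perron_le fun w hw => ?_
    have key := le_of_not_admissible (Ωp := Ωp) (Ωm := Ωm) (Γ := Γ) (w := w)
      (φ := fun y => φ y + ε * ‖y - x‖ ^ 2 + -(ε * r ^ 2)) isOpen_ball
      (isBounded_ball (x := x) (r := r)) hw.1.continuousOn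
      (fun y hy => ((hball (hcl ▸ hy)).2.1.continuousAt.add
        continuousAt_const).continuousWithinAt)
      (fun y hy => (hball (hsub hy)).2.1.add contDiffAt_const)
      (fun y hy => hw.2.2.2 y (hball (hsub hy)).2.2.2)
      (fun y hy => by
        rw [gradient_add_const, lap_add_const]
        exact (hball (hsub hy)).1)
      (fun y hy => by
        have h1 := norm_sub_eq_of_mem_frontier_ball hr hy
        have h2 := (hball (hcl ▸ frontier_subset_closure hy)).2.2.1
        have h3 := le_perron h hw y
        rw [h1]
        linarith)
      x (subset_closure (mem_ball_self hr))
    simp only [sub_self, norm_zero] at key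
    rw [heq]
    nlinarith
  have : 0 < ε * r ^ 2 := by positivity
  linarith

lemma perron_mem_subClass (h : IsDecomposition Ω Ωp Ωm Γ)
    (hLipM : UnifLipschitzBoundary Ωm) (hLipP : UnifLipschitzBoundary Ωp) :
    perron Ω Ωp Ωm Γ ∈ subClass Ω Ωp Ωm Γ :=
  ⟨continuous_perron h hLipM hLipP, fun x => le_perron h zero_mem_subClass x,
    fun _ hx => perron_eq_zero h hx, fun _ hx => subAt_perron h hx⟩

/-- If the Perron envelope belongs to the Perron family, no strict sub-solution touches it from
below. -/
lemma not_touching_perron_of_strict (h : IsDecomposition Ω Ωp Ωm Γ)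
    (hu : perron Ω Ωp Ωm Γ ∈ subClass Ω Ωp Ωm Γ) {x : Euc (n + 1)} (hx : x ∈ Ω)
    {φ : Euc (n + 1) → ℝ} (hφ : ContDiffAt ℝ 2 φ x)
    (hle : ∀ᶠ y in 𝓝 x, φ y ≤ perron Ω Ωp Ωm Γ y) (heq : perron Ω Ωp Ωm Γ x = φ x) :
    ¬ ((x ∈ Ωm ∧ ‖gradient φ x‖ < 1) ∨ (x ∈ Ωp ∧ -2 < lap φ x) ∨
      (‖gradient φ x‖ < 1 ∧ -2 < lap φ x)) := by
  intro hs
  obtain ⟨ε, hε, hεl⟩ : ∃ ε > 0, -2 < lap φ x →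
      -2 < lap φ x + -ε * (2 * ((n + 1 : ℕ) : ℝ)) := by
    by_cases hl : -2 < lap φ x
    · have hN : (0 : ℝ) < 2 * ((n + 1 : ℕ) : ℝ) := by positivity
      refine ⟨(lap φ x + 2) / 2 / (2 * ((n + 1 : ℕ) : ℝ)),
        div_pos (by linarith) hN, fun h' => ?_⟩
      rw [neg_mul, div_mul_cancel₀ _ hN.ne']
      linarith
    · exact ⟨1, one_pos, fun h' => absurd h' hl⟩
  have hψ : ContDiffAt ℝ 2 (fun y => φ y + -ε * ‖y - x‖ ^ 2) x :=
    hφ.add (contDiffAt_const.mul (contDiff_norm_sub_sq x).contDiffAt)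
  have hψa := eventually_admissible h hψ (by
    rw [gradient_add_mul_norm_sub_sq hφ, lap_add_mul_norm_sub_sq hφ]
    exact hs.imp_right (Or.imp (And.imp_right hεl) (And.imp_right hεl)))
  have hev := hψa.and ((hψ.eventually (by simp)).and (hle.and (h.isOpen.mem_nhds hx)))
  obtain ⟨r, hr, hball⟩ := Metric.nhds_basis_closedBall.eventually_iff.mp hev
  have hsub : ball x r ⊆ closedBall x r := ball_subset_closedBall
  have hcl : closure (ball x r) = closedBall x r := closure_ball x hr.ne'
  obtain ⟨w, hw, -, hvw⟩ := exists_mem_subClass_glue hu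
    (v := fun y => φ y + -ε * ‖y - x‖ ^ 2 + ε * r ^ 2) (isOpen_ball (x := x) (ε := r))
    (fun y hy => (hball (hsub hy)).2.2.2)
    (fun y hy => ((hball (hcl ▸ hy)).2.1.continuousAt.add
      continuousAt_const).continuousWithinAt)
    (fun y hy => by
      have h1 := norm_sub_eq_of_mem_frontier_ball hr hy
      have h2 := (hball (hcl ▸ frontier_subset_closure hy)).2.2.1
      rw [h1]
      linarith)
    (fun y hy => by
      refine Admissible.subAt ((hball (hsub hy)).2.1.add contDiffAt_const) ?_ le_rfl
      rw [gradient_add_const, lap_add_const]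
      exact (hball (hsub hy)).1)
  have h1 := hvw x (mem_ball_self hr)
  have h2 := le_perron h hw x
  simp only [sub_self, norm_zero] at h1
  have : 0 < ε * r ^ 2 := by positivity
  nlinarith

end

theorem statement_7 {n : ℕ}
    (Ω Ωp Ωm Γ : Set (Euc (n + 1)))
    (hΩ : IsOpen Ω) (hΩb : Bornology.IsBounded Ω) (hΩpO : IsOpen Ωp) (hΩpsub : Ωp ⊆ Ω)
    (hΩm : Ωm = Ω \ closure Ωp)
    (hΓ : Γ = Ω \ (Ωp ∪ Ωm))
    (hΓm : Γ = frontier Ωm ∩ Ω) (hΓp : Γ = frontier Ωp ∩ Ω)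
    (hLipM : UnifLipschitzBoundary Ωm) (hLipP : UnifLipschitzBoundary Ωp)
    : ∃ u : Euc (n + 1) → ℝ, ContinuousOn u (closure Ω) ∧
      (∀ x ∈ frontier Ω, u x = 0) ∧
      RelaxedSub1 Ω Ωm Ωp Γ (fun p _ _ => ‖p‖ - 1)
        (fun M _ _ _ => (1 / 2) * (-(M.trace)) - 1) u ∧
      RelaxedSuper1 Ω Ωm Ωp Γ (fun p _ _ => ‖p‖ - 1)
        (fun M _ _ _ => (1 / 2) * (-(M.trace)) - 1) u := by
  have h : IsDecomposition Ω Ωp Ωm Γ := ⟨hΩ, hΩb, hΩpO, hΩpsub, hΩm, hΓ, hΓm, hΓp⟩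
  have hu := perron_mem_subClass h hLipM hLipP
  refine ⟨perron Ω Ωp Ωm Γ, hu.1.continuousOn, fun x hx => ?_, ?_, ?_⟩
  · rw [hΩ.frontier_eq] at hx
    exact perron_eq_zero h hx.2
  · rintro x φ r ⟨hr, hball, hφ, hle, heq⟩
    have hnhds := ball_mem_nhds x hr
    obtain ⟨h1, h2, h3⟩ := subAt_perron h (hball (mem_ball_self hr)) φ
      (hφ.contDiffAt hnhds) (mem_of_superset hnhds hle) heq
    simp only [evalOp1, evalOp2, min_le_iff]
    change _ ∧ (_ → 1 / 2 * (-(lap φ x)) - 1 ≤ 0) ∧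
      (_ → _ ∨ 1 / 2 * (-(lap φ x)) - 1 ≤ 0)
    exact ⟨fun hx => by linarith [h1 hx], fun hx => by linarith [h2 hx],
      fun hx => (h3 hx).imp (fun _ => by linarith) (fun _ => by linarith)⟩
  · rintro x φ r ⟨hr, hball, hφ, hle, heq⟩
    have hnhds := ball_mem_nhds x hr
    have hns := not_touching_perron_of_strict h hu (hball (mem_ball_self hr))
      (hφ.contDiffAt hnhds) (mem_of_superset hnhds hle) heq
    push Not at hns
    obtain ⟨h1, h2, h3⟩ := hns
    simp only [evalOp1, evalOp2, le_max_iff]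
    change _ ∧ (_ → 0 ≤ 1 / 2 * (-(lap φ x)) - 1) ∧
      (_ → _ ∨ 0 ≤ 1 / 2 * (-(lap φ x)) - 1)
    refine ⟨fun hx => by linarith [h1 hx], fun hx => by linarith [h2 hx], fun _ => ?_⟩
    by_cases hg : ‖gradient φ x‖ < 1
    · right
      linarith [h3 hg]
    · left
      linarith

end
end

section
/- Let Ω ⊆ ℝⁿ be an open bounded set with uniformly Lipschitz regular boundary, and let H be a first-order degenerate elliptic operator on Ω with bounded sub-level sets. Then any bounded viscosity sub-solution u ∈ C(Ω) of Hu ≤ 0 in Ω is Lipschitz continuous on Ω, i.e. there exists L ≥ 0 with |u(x) − u(y)| ≤ L|x − y| for all x, y ∈ Ω. -/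
open Metric Set Filter Topology Bornology

noncomputable section

/-- A first-order operator is degenerate elliptic (nondecreasing in `z`) on `S`. -/
def DegElliptic1 {n : ℕ} (S : Set (Euc n)) (H : Euc n → ℝ → Euc n → ℝ) : Prop :=
  ∀ p : Euc n, ∀ z₁ z₂ : ℝ, ∀ x ∈ S, z₁ ≤ z₂ → H p z₁ x ≤ H p z₂ x

/-- A first-order operator has bounded sub-level sets on `S`. -/
def BoundedSublevels1 {n : ℕ} (S : Set (Euc n)) (H : Euc n → ℝ → Euc n → ℝ) : Prop :=
  ∀ z c : ℝ, Bornology.IsBounded {p : Euc n | ∃ x ∈ S, H p z x ≤ c}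

/-- Continuity of a first-order operator on `ℝⁿ × ℝ × S`. -/
def ContinuousOp1 {n : ℕ} (S : Set (Euc n)) (H : Euc n → ℝ → Euc n → ℝ) : Prop :=
  ContinuousOn (fun q : Euc n × ℝ × Euc n => H q.1 q.2.1 q.2.2) (univ ×ˢ univ ×ˢ S)

/-- A function on `[0, 1]` whose increments are at most `A |s - t|` up to a quadratic error
satisfies `|f 1 - f 0| ≤ A`. -/
lemma abs_sub_le_of_quadratic_increments {f : ℝ → ℝ} {A D δ : ℝ} (hδ : 0 < δ)
    (hf : ∀ s ∈ Icc (0 : ℝ) 1, ∀ t ∈ Icc (0 : ℝ) 1, |s - t| ≤ δ →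
      |f s - f t| ≤ A * |s - t| + D * |s - t| ^ 2) :
    |f 1 - f 0| ≤ A := by
  have hlim : Tendsto (fun N : ℕ => A + D * (1 / ((N : ℝ) + 1))) atTop (𝓝 A) := by
    simpa using (tendsto_one_div_add_atTop_nhds_zero_nat (𝕜 := ℝ)).const_mul D |>.const_add A
  refine ge_of_tendsto hlim ?_
  have hsmall : ∀ᶠ N : ℕ in atTop, 1 / ((N : ℝ) + 1) < δ :=
    (tendsto_one_div_add_atTop_nhds_zero_nat (𝕜 := ℝ)).eventually_lt_const hδ
  filter_upwards [hsmall] with N hN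
  have hpos : (0 : ℝ) < (N : ℝ) + 1 := by positivity
  have hsum := dist_le_range_sum_dist (fun i : ℕ => f ((i : ℝ) / ((N : ℝ) + 1))) (N + 1)
  have hstep : ∀ i ∈ Finset.range (N + 1),
      dist (f ((i : ℝ) / ((N : ℝ) + 1))) (f (((i + 1 : ℕ) : ℝ) / ((N : ℝ) + 1))) ≤
        A * (1 / ((N : ℝ) + 1)) + D * (1 / ((N : ℝ) + 1)) ^ 2 := by
    intro i hi
    have hi' : (i : ℝ) + 1 ≤ (N : ℝ) + 1 := by
      exact_mod_cast Finset.mem_range.1 hi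
    have hd : |((i + 1 : ℕ) : ℝ) / ((N : ℝ) + 1) - (i : ℝ) / ((N : ℝ) + 1)| =
        1 / ((N : ℝ) + 1) := by
      rw [← sub_div]
      push_cast
      rw [add_sub_cancel_left, abs_of_pos (by positivity)]
    rw [dist_comm, Real.dist_eq, ← hd]
    refine hf _ ⟨by positivity, ?_⟩ _ ⟨by positivity, ?_⟩ (hd.trans_le hN.le)
    · rw [div_le_one hpos]
      push_cast
      exact hi'
    · rw [div_le_one hpos]
      linarith
  have htotal := hsum.trans (Finset.sum_le_sum hstep)
  simp only [Finset.sum_const, Finset.card_range, nsmul_eq_mul] at htotal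
  push_cast at htotal
  rw [dist_comm, Real.dist_eq, div_self hpos.ne', zero_div] at htotal
  refine htotal.trans (le_of_eq ?_)
  field_simp

/-- If the gradients of all test functions touching `u` from above are bounded by `P < a`, then
`u` lies below a perturbed cone of slope `a` in every closed ball contained in the domain. -/
lemma le_add_cone_of_gradient_bound {m : ℕ} {Ω : Set (Euc m)} {u : Euc m → ℝ} {P M a R : ℝ}
    (huC : ContinuousOn u Ω) (hM : ∀ x ∈ Ω, |u x| ≤ M)
    (hgrad : ∀ x₀ φ r, SubTest Ω u x₀ φ r → ‖gradient φ x₀‖ ≤ P)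
    (ha : 0 ≤ a) (hPa : P < a) (hR : 0 < R) {y : Euc m} (hball : closedBall y R ⊆ Ω)
    {x : Euc m} (hx : x ∈ closedBall y R) :
    u x ≤ u y + (a * ‖x - y‖ + 2 * M / R ^ 2 * ‖x - y‖ ^ 2) := by
  have hy : y ∈ closedBall y R := mem_closedBall_self hR.le
  have hM0 : 0 ≤ M := (abs_nonneg _).trans (hM y (hball hy))
  set b : ℝ := 2 * M / R ^ 2 with hb
  have hb0 : 0 ≤ b := by positivity
  set ψ : Euc m → ℝ := fun w => a * ‖w - y‖ + b * ‖w - y‖ ^ 2 with hψ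
  have hψc : Continuous ψ := by fun_prop
  obtain ⟨z, hz, hmax⟩ := (isCompact_closedBall y R).exists_isMaxOn ⟨y, hy⟩
    ((huC.mono hball).sub hψc.continuousOn)
  have hmax' : ∀ w ∈ closedBall y R, u w - ψ w ≤ u z - ψ z := fun w hw => hmax hw
  have hψy : ψ y = 0 := by simp [hψ]
  suffices hzy : u z - ψ z ≤ u y by
    have := hmax' x hx
    change u x ≤ u y + ψ x
    linarith
  by_contra! hlt
  have hne : z - y ≠ 0 := by
    intro h
    rw [sub_eq_zero.1 h, hψy] at hlt
    linarith
  have hnpos : 0 < ‖z - y‖ := norm_pos_iff.2 hne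
  have hzR : ‖z - y‖ < R := by
    refine lt_of_le_of_ne (mem_closedBall_iff_norm.1 hz) fun h => ?_
    have hbR : b * R ^ 2 = 2 * M := by rw [hb]; field_simp
    have hψz : ψ z = a * R + 2 * M := by simp only [hψ, h, hbR]
    have h1 := (abs_le.1 (hM z (hball hz))).2
    have h2 := (abs_le.1 (hM y (hball hy))).1
    have h3 : 0 ≤ a * R := by positivity
    linarith
  set φ : Euc m → ℝ := fun w => (u z - ψ z) + ψ w with hφ
  have hsmooth : ∀ w, w - y ≠ 0 → ContDiffAt ℝ 2 φ w := by
    intro w hw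
    have hn : ContDiffAt ℝ 2 (fun w : Euc m => ‖w - y‖) w :=
      (contDiffAt_id.sub contDiffAt_const).norm ℝ hw
    exact contDiffAt_const.add ((contDiffAt_const.mul hn).add (contDiffAt_const.mul (hn.pow 2)))
  have hsub : ball z (min (R - ‖z - y‖) ‖z - y‖) ⊆ closedBall y R := by
    intro w hw
    rw [mem_ball_iff_norm, lt_min_iff] at hw
    rw [mem_closedBall_iff_norm]
    have := norm_sub_le_norm_sub_add_norm_sub w z y
    linarith
  have htest : SubTest Ω u z φ (min (R - ‖z - y‖) ‖z - y‖) := by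
    refine ⟨lt_min (sub_pos.2 hzR) hnpos, hsub.trans hball, fun w hw => ?_, fun w hw => ?_, ?_⟩
    · refine (hsmooth w fun h => ?_).contDiffWithinAt
      rw [sub_eq_zero.1 h, mem_ball_iff_norm, norm_sub_rev] at hw
      exact absurd hw (not_lt.2 (min_le_right _ _))
    · have := hmax' w (hsub hw)
      simp only [hφ]
      linarith
    · simp [hφ]
  have hP := hgrad z φ _ htest
  have hdφ : DifferentiableAt ℝ φ z := (hsmooth z hne).differentiableAt (by norm_num)
  have hinner : inner ℝ (gradient φ z) (z - y) = a * ‖z - y‖ + 2 * b * ‖z - y‖ ^ 2 := by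
    have h1 : HasDerivAt (fun t : ℝ => φ (y + t • (z - y)))
        (inner ℝ (gradient φ z) (z - y)) 1 := by
      have hγ : HasDerivAt (fun t : ℝ => y + t • (z - y)) (z - y) 1 := by
        simpa using ((hasDerivAt_id (1 : ℝ)).smul_const (z - y)).const_add y
      have hφ' : HasFDerivAt φ (fderiv ℝ φ z) (y + (1 : ℝ) • (z - y)) := by
        simpa using hdφ.hasFDerivAt
      have h := hφ'.comp_hasDerivAt (1 : ℝ) hγ
      simpa [gradient, Function.comp_def] using h
    have h2 : HasDerivAt (fun t : ℝ => φ (y + t • (z - y)))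
        (a * ‖z - y‖ + 2 * b * ‖z - y‖ ^ 2) 1 := by
      have hpoly : HasDerivAt
          (fun t : ℝ => (u z - ψ z) + (a * (t * ‖z - y‖) + b * (t * ‖z - y‖) ^ 2))
          (a * ‖z - y‖ + 2 * b * ‖z - y‖ ^ 2) 1 := by
        have hlin : HasDerivAt (fun t : ℝ => t * ‖z - y‖) ‖z - y‖ 1 := by
          simpa using (hasDerivAt_id (1 : ℝ)).mul_const ‖z - y‖
        refine (((hlin.const_mul a).add ((hlin.pow 2).const_mul b)).const_add
          (u z - ψ z)).congr_deriv ?_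
        push_cast
        ring
      refine hpoly.congr_of_eventuallyEq ?_
      filter_upwards [lt_mem_nhds (zero_lt_one' ℝ)] with t ht
      simp [hφ, hψ, norm_smul, abs_of_pos ht]
    exact h1.unique h2
  have hcs := real_inner_le_norm (gradient φ z) (z - y)
  have hsq : 0 ≤ 2 * b * ‖z - y‖ ^ 2 := by positivity
  have hlt' : ‖gradient φ z‖ * ‖z - y‖ < a * ‖z - y‖ :=
    mul_lt_mul_of_pos_right (hP.trans_lt hPa) hnpos
  linarith

/-- Under the same gradient bound, the increment of `u` along a `C`-Lipschitz curve in the domain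
is at most `a * C`. -/
lemma abs_sub_le_along_curve {m : ℕ} {Ω : Set (Euc m)} {u : Euc m → ℝ} {P M a : ℝ}
    (hΩ : IsOpen Ω) (huC : ContinuousOn u Ω) (hM : ∀ x ∈ Ω, |u x| ≤ M)
    (hgrad : ∀ x₀ φ r, SubTest Ω u x₀ φ r → ‖gradient φ x₀‖ ≤ P)
    (ha : 0 ≤ a) (hPa : P < a) {γ : ℝ → Euc m} {C : ℝ} (hC : 0 ≤ C)
    (hγ : ∀ s ∈ Icc (0 : ℝ) 1, ∀ t ∈ Icc (0 : ℝ) 1, ‖γ s - γ t‖ ≤ C * |s - t|)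
    (hγΩ : MapsTo γ (Icc 0 1) Ω) :
    |u (γ 1) - u (γ 0)| ≤ a * C := by
  have hγc : ContinuousOn γ (Icc 0 1) := by
    refine (LipschitzOnWith.of_dist_le_mul (K := C.toNNReal) fun s hs t ht => ?_).continuousOn
    rw [dist_eq_norm, Real.dist_eq, Real.coe_toNNReal C hC]
    exact hγ s hs t ht
  obtain ⟨R, hR, hRΩ⟩ := (isCompact_Icc.image_of_continuousOn hγc).exists_cthickening_subset_open
    hΩ hγΩ.image_subset
  have hball : ∀ s ∈ Icc (0 : ℝ) 1, closedBall (γ s) R ⊆ Ω := fun s hs =>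
    (closedBall_subset_cthickening (mem_image_of_mem γ hs) R).trans hRΩ
  have hM0 : 0 ≤ M := (abs_nonneg _).trans (hM _ (hγΩ (left_mem_Icc.2 zero_le_one)))
  have hδ : 0 < R / (C + 1) := by positivity
  have hone : ∀ s ∈ Icc (0 : ℝ) 1, ∀ t ∈ Icc (0 : ℝ) 1, |s - t| ≤ R / (C + 1) →
      u (γ s) - u (γ t) ≤ a * C * |s - t| + 2 * M / R ^ 2 * C ^ 2 * |s - t| ^ 2 := by
    intro s hs t ht hst
    have hinc := hγ s hs t ht
    have hmem : γ s ∈ closedBall (γ t) R := by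
      rw [mem_closedBall_iff_norm]
      rw [le_div_iff₀ (by positivity)] at hst
      nlinarith [abs_nonneg (s - t)]
    have hcone := le_add_cone_of_gradient_bound huC hM hgrad ha hPa hR (hball t ht) hmem
    have h1 : a * ‖γ s - γ t‖ ≤ a * (C * |s - t|) := by gcongr
    have h2 : 2 * M / R ^ 2 * ‖γ s - γ t‖ ^ 2 ≤ 2 * M / R ^ 2 * (C * |s - t|) ^ 2 := by gcongr
    rw [mul_pow] at h2
    linarith
  refine abs_sub_le_of_quadratic_increments (f := fun t => u (γ t))
    (D := 2 * M / R ^ 2 * C ^ 2) hδ fun s hs t ht hst => ?_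
  refine abs_sub_le_iff.2 ⟨hone s hs t ht hst, ?_⟩
  have hts := hone t ht s hs (by rwa [abs_sub_comm])
  rwa [abs_sub_comm t s] at hts

/-- Points of a convex parameter domain with bi-Lipschitz image in `Ω` are mapped to points
between which `u` is Lipschitz. -/
lemma abs_sub_le_of_convex_chart {m : ℕ} {Ω : Set (Euc m)} {u : Euc m → ℝ} {P M a : ℝ}
    (hΩ : IsOpen Ω) (huC : ContinuousOn u Ω) (hM : ∀ x ∈ Ω, |u x| ≤ M)
    (hgrad : ∀ x₀ φ r, SubTest Ω u x₀ φ r → ‖gradient φ x₀‖ ≤ P)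
    (ha : 0 ≤ a) (hPa : P < a) {Φ : Euc m → Euc m} {K : NNReal} {B : Set (Euc m)}
    (hB : Convex ℝ B) (hΦ : LipschitzOnWith K Φ B) (hΦΩ : MapsTo Φ B Ω)
    {p q : Euc m} (hp : p ∈ B) (hq : q ∈ B) :
    |u (Φ p) - u (Φ q)| ≤ a * (K * ‖p - q‖) := by
  have hseg : ∀ t ∈ Icc (0 : ℝ) 1, AffineMap.lineMap q p t ∈ B := fun t ht =>
    hB.lineMap_mem hq hp ht
  have h := abs_sub_le_along_curve (γ := fun t : ℝ => Φ (AffineMap.lineMap q p t))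
    (C := K * ‖p - q‖) hΩ huC hM hgrad ha hPa (by positivity) (fun s hs t ht => ?_)
    fun t ht => hΦΩ (hseg t ht)
  · simpa using h
  · have hd := hΦ.dist_le_mul _ (hseg s hs) _ (hseg t ht)
    rw [dist_lineMap_lineMap, dist_eq_norm, dist_eq_norm q p, norm_sub_rev q p,
      Real.dist_eq] at hd
    linarith

/-- A bounded function on a bounded set that is Lipschitz with a common constant near each point
of the closure is Lipschitz. -/
lemma exists_lipschitz_of_locally_on_closure {m : ℕ} {Ω : Set (Euc m)} {u : Euc m → ℝ} {M L : ℝ}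
    (hΩb : IsBounded Ω) (hM : ∀ x ∈ Ω, |u x| ≤ M)
    (hloc : ∀ x₀ ∈ closure Ω, ∃ V ∈ 𝓝 x₀, ∀ x ∈ V ∩ Ω, ∀ y ∈ V ∩ Ω,
      |u x - u y| ≤ L * ‖x - y‖) :
    ∃ L' : ℝ, 0 ≤ L' ∧ ∀ x ∈ Ω, ∀ y ∈ Ω, |u x - u y| ≤ L' * ‖x - y‖ := by
  choose! V hV hVL using hloc
  obtain ⟨δ, hδ, hleb⟩ := lebesgue_number_lemma_of_metric (c := fun x : closure Ω => interior (V x))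
    hΩb.isCompact_closure (fun _ => isOpen_interior) fun x hx =>
      mem_iUnion.2 ⟨⟨x, hx⟩, mem_interior_iff_mem_nhds.2 (hV x hx)⟩
  refine ⟨max (max L (2 * M / δ)) 0, le_max_right _ _, fun x hx y hy => ?_⟩
  by_cases hxy : ‖x - y‖ < δ
  · obtain ⟨x₀, hx₀⟩ := hleb x (subset_closure hx)
    have hyb : y ∈ ball x δ := by rwa [mem_ball_iff_norm, norm_sub_rev]
    refine (hVL x₀ x₀.2 x ⟨interior_subset (hx₀ (mem_ball_self hδ)), hx⟩ y
      ⟨interior_subset (hx₀ hyb), hy⟩).trans ?_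
    gcongr
    exact (le_max_left _ _).trans (le_max_left _ _)
  · have h1 : |u x - u y| ≤ 2 * M := by
      have := abs_sub (u x) (u y)
      linarith [hM x hx, hM y hy]
    have hM0 : 0 ≤ M := (abs_nonneg _).trans (hM x hx)
    calc |u x - u y| ≤ 2 * M / δ * δ := by rwa [div_mul_cancel₀ _ hδ.ne']
      _ ≤ 2 * M / δ * ‖x - y‖ := by gcongr; exact not_lt.1 hxy
      _ ≤ _ := by
        gcongr
        exact (le_max_right _ _).trans (le_max_left _ _)

/-- For a sub-solution bounded below, gradients of touching test functions are bounded. -/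
lemma exists_gradient_bound_of_subsolution {m : ℕ} {Ω : Set (Euc m)}
    {H : Euc m → ℝ → Euc m → ℝ} (hHDE : DegElliptic1 Ω H) (hHBS : BoundedSublevels1 Ω H)
    {u : Euc m → ℝ} {M : ℝ} (hM : ∀ x ∈ Ω, |u x| ≤ M)
    (husub : ∀ x₀ φ r, SubTest Ω u x₀ φ r → evalOp1 H φ x₀ ≤ 0) :
    ∃ P : ℝ, ∀ x₀ φ r, SubTest Ω u x₀ φ r → ‖gradient φ x₀‖ ≤ P := by
  obtain ⟨P, hP⟩ := (hHBS (-M) 0).exists_norm_le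
  refine ⟨P, fun x₀ φ r h => hP _ ?_⟩
  have hx₀ : x₀ ∈ Ω := h.2.1 (mem_ball_self h.1)
  refine ⟨x₀, hx₀, (hHDE _ _ _ x₀ hx₀ ?_).trans (husub x₀ φ r h)⟩
  rw [← h.2.2.2.2]
  exact (abs_le.1 (hM x₀ hx₀)).1

theorem statement_10 {n : ℕ} (Ω : Set (Euc (n + 1)))
    (hΩ : IsOpen Ω) (hΩb : Bornology.IsBounded Ω) (hLip : UnifLipschitzBoundary Ω)
    (H : Euc (n + 1) → ℝ → Euc (n + 1) → ℝ)
    (hHDE : DegElliptic1 Ω H) (hHC : ContinuousOp1 Ω H) (hHBS : BoundedSublevels1 Ω H)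
    (u : Euc (n + 1) → ℝ) (huC : ContinuousOn u Ω)
    (hub : ∃ M : ℝ, ∀ x ∈ Ω, |u x| ≤ M)
    (husub : ∀ x₀ : Euc (n + 1), ∀ φ : Euc (n + 1) → ℝ, ∀ r : ℝ, SubTest Ω u x₀ φ r →
      evalOp1 H φ x₀ ≤ 0) :
    ∃ L : ℝ, 0 ≤ L ∧ ∀ x ∈ Ω, ∀ y ∈ Ω, |u x - u y| ≤ L * ‖x - y‖ := by
  obtain ⟨M, hM⟩ := hub
  obtain ⟨P, hgrad⟩ := exists_gradient_bound_of_subsolution hHDE hHBS hM husub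
  obtain ⟨K, -, hK⟩ := hLip
  set a : ℝ := max 0 P + 1
  have ha : 0 ≤ a := by positivity
  have hPa : P < a := (le_max_right 0 P).trans_lt (lt_add_one _)
  refine exists_lipschitz_of_locally_on_closure (L := a * (K * K + 1)) hΩb hM fun x₀ hx₀ => ?_
  by_cases hx₀Ω : x₀ ∈ Ω
  · obtain ⟨r, hr, hrΩ⟩ := Metric.isOpen_iff.1 hΩ x₀ hx₀Ω
    refine ⟨ball x₀ r, ball_mem_nhds x₀ hr, fun x hx y hy => ?_⟩
    have h := abs_sub_le_of_convex_chart hΩ huC hM hgrad ha hPa (convex_ball x₀ r)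
      LipschitzWith.id.lipschitzOnWith hrΩ hx.1 hy.1
    rw [NNReal.coe_one, one_mul] at h
    refine h.trans ?_
    gcongr
    exact le_mul_of_one_le_right ha (le_add_of_nonneg_left (by positivity))
  · have hfr : x₀ ∈ frontier Ω := by
      rw [hΩ.frontier_eq]
      exact ⟨hx₀, hx₀Ω⟩
    obtain ⟨Φ, Ψ, U, hU, hxU, -, -, hΦ, hΨ, hΨΦ, -, -, hpos, -⟩ := hK x₀ hfr
    set B : Set (Euc (n + 1)) := ball 0 1 ∩ {x | 0 < x (Fin.last n)}
    have hBconv : Convex ℝ B :=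
      (convex_ball 0 1).inter (convex_halfSpace_gt
        (f := fun x : Euc (n + 1) => x (Fin.last n))
        ⟨fun _ _ => rfl, fun _ _ => rfl⟩ 0)
    have hmaps : MapsTo Φ B Ω := fun p hp => (hpos.subset (mem_image_of_mem Φ hp)).2
    refine ⟨U, hU.mem_nhds hxU, fun x hx y hy => ?_⟩
    obtain ⟨p, hp, rfl⟩ := hpos.superset hx
    obtain ⟨q, hq, rfl⟩ := hpos.superset hy
    have h := abs_sub_le_of_convex_chart hΩ huC hM hgrad ha hPa hBconv
      (hΦ.mono inter_subset_left) hmaps hp hq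
    have hd := hΨ.dist_le_mul _ hx.1 _ hy.1
    rw [hΨΦ p hp.1, hΨΦ q hq.1, dist_eq_norm, dist_eq_norm] at hd
    calc |u (Φ p) - u (Φ q)| ≤ a * (K * ‖p - q‖) := h
      _ ≤ a * (K * (K * ‖Φ p - Φ q‖)) := by gcongr
      _ = a * (K * K) * ‖Φ p - Φ q‖ := by ring
      _ ≤ a * (K * K + 1) * ‖Φ p - Φ q‖ := by gcongr; linarith
end
end
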